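/- General Hoeffding bound for affine PaRIS statistics: under (H1) and (H2), for all n ∈ ℕ, additive functional h_n, bounded measurable f_n and f̃_n on X_n, and M ≥ 1, there exist c_n > 0 and d_n > 0 such that for all N ≥ 1 and ϵ > 0: (i) P( | N^{−1} Σ_{i=1}^N ω_n^i { τ_n^i f_n(ξ_n^i) + f̃_n(ξ_n^i) } − φ^ε_{n−1} L^ε_{n−1}( T^ε_n h_n · f_n + f̃_n ) / φ^ε_{n−1} ϑ_{n−1} | ≥ ϵ ) ≤ c_n exp(−d_n N ϵ²), and (ii) P( | Σ_{i=1}^N (ω_n^i/Ω_n) { τ_n^i f_n(ξ_n^i) + f̃_n(ξ_n^i) } − φ^ε_n( T^ε_n h_n · f_n + f̃_n ) | ≥ ϵ ) ≤ c_n exp(−d_n N ϵ²). -/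

import Mathlib

open MeasureTheory ProbabilityTheory Filter

namespace PmParis

variable {X : ℕ → Type*} [∀ n, MeasurableSpace (X n)]
/-- Path space `X_0 × ⋯ × X_n`. -/
abbrev Path (X : ℕ → Type*) (n : ℕ) := (i : Fin (n + 1)) → X i

/-- Unnormalised path integral `χ L_0 ⋯ L_{n-1} h`, where `L_k` is the kernel with
density `d k` with respect to `μ (k+1)`. -/
noncomputable def pathInt (μ : ∀ n, Measure (X n)) (χ : Measure (X 0))
    (d : ∀ k, X k → X (k + 1) → ℝ) : (n : ℕ) → (Path X n → ℝ) → ℝ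
  | 0, h => ∫ x, h (Fin.cons x fun i => i.elim0) ∂χ
  | n + 1, h =>
      pathInt μ χ d n fun p =>
        ∫ y, d n (p (Fin.last n)) y * h (Fin.snoc p y) ∂μ (n + 1)

/-- The (normalised) path measure `φ_{0:n}` as an integral functional. -/
noncomputable def smoothPath (μ : ∀ n, Measure (X n)) (χ : Measure (X 0))
    (d : ∀ k, X k → X (k + 1) → ℝ) (n : ℕ) (h : Path X n → ℝ) : ℝ :=
  pathInt μ χ d n h / pathInt μ χ d n fun _ => 1

/-- Last-coordinate marginal `φ_n` of `φ_{0:n}`, as an integral functional. -/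
noncomputable def marg (μ : ∀ n, Measure (X n)) (χ : Measure (X 0))
    (d : ∀ k, X k → X (k + 1) → ℝ) (n : ℕ) (f : X n → ℝ) : ℝ :=
  smoothPath μ χ d n fun p => f (p (Fin.last n))

/-- The kernel operator `L_n f (x) = ∫ d n x y * f y dμ (n+1)`. -/
noncomputable def Lop (μ : ∀ n, Measure (X n))
    (d : ∀ k, X k → X (k + 1) → ℝ) (n : ℕ) (f : X (n + 1) → ℝ) (x : X n) : ℝ :=
  ∫ y, d n x y * f y ∂μ (n + 1)

/-- The backward kernel operator `B_n g (x') = φ_n(d n (·) x' * g) / φ_n(d n (·) x')`. -/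
noncomputable def Bop (μ : ∀ n, Measure (X n)) (χ : Measure (X 0))
    (d : ∀ k, X k → X (k + 1) → ℝ) (n : ℕ) (g : X n → ℝ) (x' : X (n + 1)) : ℝ :=
  marg μ χ d n (fun x => d n x x' * g x) / marg μ χ d n fun x => d n x x'

/-- `T_n h (x_n) = ∫ h(x_{0:n}) ∏_{m<n} B_m(x_{m+1}, dx_m)`: iterated backward kernel. -/
noncomputable def Tback (μ : ∀ n, Measure (X n)) (χ : Measure (X 0))
    (d : ∀ k, X k → X (k + 1) → ℝ) : (n : ℕ) → (Path X n → ℝ) → X n → ℝ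
  | 0, h, x => h (Fin.cons x fun i => i.elim0)
  | n + 1, h, x' =>
      Bop μ χ d n (fun x => Tback μ χ d n (fun p => h (Fin.snoc p x')) x) x'

/-- Iterated kernel `L_m ⋯ L_{n-1} f` evaluated at level `m` (equal to `f` when `m = n`,
junk `0` when `m > n`). -/
noncomputable def Kpow (μ : ∀ n, Measure (X n))
    (d : ∀ k, X k → X (k + 1) → ℝ) (n : ℕ) (f : X n → ℝ) (m : ℕ) : X m → ℝ :=
  if _hm : m < n then fun x => ∫ y, d m x y * Kpow μ d n f (m + 1) y ∂μ (m + 1)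
  else fun x => if hm2 : m = n then f (hm2 ▸ x) else 0
termination_by n - m
decreasing_by omega

/-- Prospective (forward) integral: given a prefix `x_{0:m}`, integrate `h` over the
remaining coordinates `x_{m+1:n}` using the kernels with densities `d`. -/
noncomputable def Fwd (μ : ∀ n, Measure (X n))
    (d : ∀ k, X k → X (k + 1) → ℝ) (n : ℕ) (h : Path X n → ℝ) (m : ℕ) :
    Path X m → ℝ :=
  if _hm : m < n then fun p =>
    ∫ y, d m (p (Fin.last m)) y * Fwd μ d n h (m + 1) (Fin.snoc p y) ∂μ (m + 1)
  else fun p => if hm2 : m = n then h (cast (congrArg (Path X) hm2) p) else 0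
termination_by n - m
decreasing_by omega

/-- Additive functional `h_n(x_{0:n}) = ∑_{m<n} h̃_m(x_m, x_{m+1})`. -/
noncomputable def addFun (htil : ∀ k, X k → X (k + 1) → ℝ) (n : ℕ) (p : Path X n) : ℝ :=
  ∑ m : Fin n, htil m (p m.castSucc) (p m.succ)

/-- Mixed retrospective–prospective kernel: backward with `B`s of the family `dB`,
forward with kernels of the family `dF`. -/
noncomputable def mixOp (μ : ∀ n, Measure (X n)) (χ : Measure (X 0))
    (dB dF : ∀ k, X k → X (k + 1) → ℝ) (n : ℕ) (h : Path X n → ℝ) (m : ℕ) (x : X m) : ℝ :=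
  Tback μ χ dB m (Fwd μ dF n h m) x

/-- Centered retrospective–prospective kernel `𝓡̄_{m,n} h = 𝓡_{m,n}(h − φ_{0:n} h)`. -/
noncomputable def Rbar (μ : ∀ n, Measure (X n)) (χ : Measure (X 0))
    (d : ∀ k, X k → X (k + 1) → ℝ) (n : ℕ) (h : Path X n → ℝ) (m : ℕ) (x : X m) : ℝ :=
  mixOp μ χ d d n (fun p => h p - smoothPath μ χ d n h) m x


variable {Z : ℕ → Type*} [∀ n, MeasurableSpace (Z n)]

/-- Normalise a measure to a probability measure (junk if the total mass is `0` or `∞`). -/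
noncomputable def normalize {α : Type*} [MeasurableSpace α] (m : Measure α) : Measure α :=
  (m Set.univ)⁻¹ • m

/-- State of the particle system at time `n`: for each particle index, the particle
position `ξ`, the PaRIS statistic `τ` and the importance weight `ω`. -/
abbrev PState (X : ℕ → Type*) (N n : ℕ) := Fin N → X n × ℝ × ℝ

/-- Law of one pair `(J, ζ)` of backward index and auxiliary variable: the distribution on
`{1,…,N} × Z` proportional to `ω^j ℓ̂_n⟨z⟩(ξ^j, x') R_n(ξ^j, x', dz)`. -/
noncomputable def bwdMeas (R : ∀ k, Kernel (X k × X (k + 1)) (Z k))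
    (lhat : ∀ k, X k → X (k + 1) → Z k → ℝ) {N : ℕ} (n : ℕ)
    (s : PState X N n) (x' : X (n + 1)) : Measure (Fin N × Z n) :=
  normalize (Measure.sum fun j : Fin N =>
    (((R n ((s j).1, x')).withDensity fun z =>
        ENNReal.ofReal ((s j).2.2 * lhat n (s j).1 x' z)).map fun z => (j, z)))

/-- Law of the backward-sampling statistic
`τ' = M⁻¹ ∑_{j<M} (τ^{J_j} + h̃_n(ξ^{J_j}, x'))` based on `M` i.i.d. draws from `bwdMeas`. -/
noncomputable def bsLaw (R : ∀ k, Kernel (X k × X (k + 1)) (Z k))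
    (lhat : ∀ k, X k → X (k + 1) → Z k → ℝ)
    (htil : ∀ k, X k → X (k + 1) → ℝ) {N : ℕ} (M n : ℕ)
    (s : PState X N n) (x' : X (n + 1)) : Measure ℝ :=
  (Measure.pi fun _ : Fin M => bwdMeas R lhat n s x').map fun J =>
    (M : ℝ)⁻¹ * ∑ j : Fin M, ((s (J j).1).2.1 + htil n (s (J j).1).1 x')

/-- Conditional law of one new particle triple `(ξ', τ', ω')` given the time-`n` state `s`
(pseudo-marginal PaRIS update). -/
noncomputable def partLaw (μ : ∀ n, Measure (X n))
    (R : ∀ k, Kernel (X k × X (k + 1)) (Z k))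
    (lhat : ∀ k, X k → X (k + 1) → Z k → ℝ)
    (htil : ∀ k, X k → X (k + 1) → ℝ)
    (ϑ : ∀ k, X k → ℝ) (pr : ∀ k, X k → X (k + 1) → ℝ) {N : ℕ} (M n : ℕ)
    (s : PState X N n) : Measure (X (n + 1) × ℝ × ℝ) :=
  normalize (Measure.sum fun I : Fin N =>
    ENNReal.ofReal (ϑ n (s I).1 * (s I).2.2) •
      (((μ (n + 1)).withDensity fun y => ENNReal.ofReal (pr n (s I).1 y)).bind fun x' =>
        ((bsLaw R lhat htil M n s x').prod
            ((R n ((s I).1, x')).map fun z =>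
              lhat n (s I).1 x' z / (ϑ n (s I).1 * pr n (s I).1 x'))).map
          fun q => (x', q.1, q.2)))

/-- Law of the whole particle system produced by `n` iterations of the pseudo-marginal
PaRIS algorithm with `N` particles and `M` backward samples. -/
noncomputable def sysLaw (μ : ∀ n, Measure (X n)) (ν : Measure (X 0))
    (R : ∀ k, Kernel (X k × X (k + 1)) (Z k))
    (lhat : ∀ k, X k → X (k + 1) → Z k → ℝ)
    (htil : ∀ k, X k → X (k + 1) → ℝ)
    (ϑ : ∀ k, X k → ℝ) (pr : ∀ k, X k → X (k + 1) → ℝ)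
    (wm1 : X 0 → ℝ) (N M : ℕ) : (n : ℕ) → Measure (PState X N n)
  | 0 => (Measure.pi fun _ : Fin N => ν).map fun ξ i => (ξ i, 0, wm1 (ξ i))
  | n + 1 =>
      (sysLaw μ ν R lhat htil ϑ pr wm1 N M n).bind fun s =>
        Measure.pi fun _ : Fin N => partLaw μ R lhat htil ϑ pr M n s

/-- Self-normalised PaRIS estimator `∑_i (ω^i/Ω) τ^i`. -/
noncomputable def estParis {N n : ℕ} (s : PState X N n) : ℝ :=
  (∑ i, (s i).2.2 * (s i).2.1) / ∑ i, (s i).2.2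

/-- Estimated transition density `ℓ^ε_n(x, y) := ∫ ℓ̂_n⟨z⟩(x, y) R_n(x, y, dz)`. -/
noncomputable def lEps (R : ∀ k, Kernel (X k × X (k + 1)) (Z k))
    (lhat : ∀ k, X k → X (k + 1) → Z k → ℝ) (k : ℕ) (x : X k) (y : X (k + 1)) : ℝ :=
  ∫ z, lhat k x y z ∂(R k (x, y))



/-- The statistics `A N`, defined on the probability spaces `(Ω N, P N)`, concentrate around `a`
with Hoeffding-type exponential tails, uniformly in `N ≥ 1`. -/
def ConcentratesAt {Ω : ℕ → Type*} [∀ N, MeasurableSpace (Ω N)] (P : ∀ N, Measure (Ω N))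
    (A : ∀ N, Ω N → ℝ) (a : ℝ) : Prop :=
  ∃ c > (0 : ℝ), ∃ d > (0 : ℝ), ∀ N : ℕ, 1 ≤ N → ∀ ε : ℝ, 0 < ε →
    P N {ω | ε ≤ |A N ω - a|} ≤ ENNReal.ofReal (c * Real.exp (-(d * N * ε ^ 2)))

section Concentration

variable {Ω : ℕ → Type*} [∀ N, MeasurableSpace (Ω N)] {P : ∀ N, Measure (Ω N)}

lemma ConcentratesAt.div {A B : ∀ N, Ω N → ℝ} {a b K : ℝ} (hA : ConcentratesAt P A a)
    (hB : ConcentratesAt P B b) (hb : 0 < b) (hK : 0 ≤ K)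
    (h : ∀ N, ∀ᵐ ω ∂P N, |A N ω| ≤ K * |B N ω|) :
    ConcentratesAt P (fun N ω => A N ω / B N ω) (a / b) := by
  obtain ⟨cA, hcA, dA, hdA, hA⟩ := hA
  obtain ⟨cB, hcB, dB, hdB, hB⟩ := hB
  refine ⟨cA + cB, by positivity, min (dA * (b / 2) ^ 2) (dB * (b / (2 * (K + 1))) ^ 2),
    lt_min (by positivity) (by positivity), fun N hN ε hε => ?_⟩
  have hsub : P N {ω | ε ≤ |A N ω / B N ω - a / b|} ≤
      P N ({ω | b / 2 * ε ≤ |A N ω - a|} ∪ {ω | b / (2 * (K + 1)) * ε ≤ |B N ω - b|}) := by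
    refine measure_mono_ae ?_
    filter_upwards [h N] with ω hω hε'
    change ε ≤ |A N ω / B N ω - a / b| at hε'
    change b / 2 * ε ≤ |A N ω - a| ∨ b / (2 * (K + 1)) * ε ≤ |B N ω - b|
    have hAB : A N ω / B N ω * B N ω = A N ω := by
      by_cases hB0 : B N ω = 0
      · have : A N ω = 0 := by simpa [hB0] using hω
        simp [this]
      · field_simp
    have hr : |A N ω / B N ω| ≤ K := by
      rw [abs_div]
      exact div_le_of_le_mul₀ (abs_nonneg _) hK hω
    have hid : b * (A N ω / B N ω - a / b) =
        (A N ω / B N ω) * (b - B N ω) + (A N ω - a) := by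
      rw [mul_sub, mul_sub, hAB, mul_div_cancel₀ _ hb.ne']
      ring
    have hle : b * ε ≤ K * |B N ω - b| + |A N ω - a| := by
      calc b * ε ≤ b * |A N ω / B N ω - a / b| := by gcongr
        _ = |(A N ω / B N ω) * (b - B N ω) + (A N ω - a)| := by
          rw [← hid, abs_mul, abs_of_pos hb]
        _ ≤ |A N ω / B N ω| * |b - B N ω| + |A N ω - a| :=
          (abs_add_le _ _).trans_eq (by rw [abs_mul])
        _ ≤ K * |B N ω - b| + |A N ω - a| := by
          rw [abs_sub_comm b]
          gcongr
    by_contra! hcon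
    obtain ⟨h1, h2⟩ := hcon
    have h3 : K * |B N ω - b| ≤ b / 2 * ε := by
      calc K * |B N ω - b| ≤ (K + 1) * (b / (2 * (K + 1)) * ε) := by gcongr; linarith
        _ = b / 2 * ε := by field_simp
    linarith
  have hexp : ∀ d' r : ℝ, min (dA * (b / 2) ^ 2) (dB * (b / (2 * (K + 1))) ^ 2) ≤ d' * r ^ 2 →
      Real.exp (-(d' * N * (r * ε) ^ 2)) ≤ Real.exp
        (-(min (dA * (b / 2) ^ 2) (dB * (b / (2 * (K + 1))) ^ 2) * N * ε ^ 2)) := by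
    intro d' r hr
    rw [Real.exp_le_exp, neg_le_neg_iff, show d' * N * (r * ε) ^ 2 = d' * r ^ 2 * N * ε ^ 2 by ring]
    gcongr
  refine hsub.trans ((measure_union_le _ _).trans ?_)
  rw [add_mul, ENNReal.ofReal_add (by positivity) (by positivity)]
  refine add_le_add ((hA N hN _ (by positivity)).trans (ENNReal.ofReal_le_ofReal ?_))
    ((hB N hN _ (by positivity)).trans (ENNReal.ofReal_le_ofReal ?_))
  · exact mul_le_mul_of_nonneg_left (hexp _ _ (min_le_left _ _)) hcA.le
  · exact mul_le_mul_of_nonneg_left (hexp _ _ (min_le_right _ _)) hcB.le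

/-- Concentration propagates through a sampling step: if the conditional means `m N s` concentrate
around `a` and `A'` concentrates conditionally around `m N s`, then `A'` concentrates around `a`. -/
lemma ConcentratesAt.bind {Ω' : ℕ → Type*} [∀ N, MeasurableSpace (Ω' N)]
    {κ : ∀ N, Ω N → Measure (Ω' N)} {m : ∀ N, Ω N → ℝ} {A' : ∀ N, Ω' N → ℝ} {a d₀ : ℝ}
    (hm : ConcentratesAt P m a) (hP : ∀ N, P N Set.univ ≤ 1) (hκ : ∀ N s, κ N s Set.univ ≤ 1)
    (hA' : ∀ N, Measurable (A' N)) (hd₀ : 0 < d₀)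
    (h : ∀ N, 1 ≤ N → ∀ᵐ s ∂P N, ∀ ε : ℝ, 0 < ε →
      κ N s {ω | ε ≤ |A' N ω - m N s|} ≤ ENNReal.ofReal (2 * Real.exp (-(d₀ * N * ε ^ 2)))) :
    ConcentratesAt (fun N => (P N).bind (κ N)) A' a := by
  obtain ⟨c, hc, d, hd, hm⟩ := hm
  refine ⟨c + 2, by positivity, min d d₀ / 4, by positivity, fun N hN ε hε => ?_⟩
  have hmeas : MeasurableSet {ω | ε ≤ |A' N ω - a|} :=
    measurableSet_le measurable_const ((hA' N).sub_const a).abs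
  have hpt : ∀ᵐ s ∂P N, κ N s {ω | ε ≤ |A' N ω - a|} ≤
      Set.indicator {s | ε / 2 ≤ |m N s - a|} 1 s +
        ENNReal.ofReal (2 * Real.exp (-(d₀ * N * (ε / 2) ^ 2))) := by
    filter_upwards [h N hN] with s hs
    by_cases hsm : ε / 2 ≤ |m N s - a|
    · rw [Set.indicator_of_mem (by exact hsm)]
      exact ((measure_mono (Set.subset_univ _)).trans (hκ N s)).trans le_self_add
    · refine le_trans ?_ ((hs (ε / 2) (by positivity)).trans le_add_self)
      refine measure_mono fun ω hω => ?_
      change ε ≤ |A' N ω - a| at hω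
      change ε / 2 ≤ |A' N ω - m N s|
      have := abs_sub_le (A' N ω) (m N s) a
      linarith
  have hexp : ∀ d', min d d₀ ≤ d' →
      Real.exp (-(d' * N * (ε / 2) ^ 2)) ≤ Real.exp (-(min d d₀ / 4 * N * ε ^ 2)) := by
    intro d' hd'
    rw [Real.exp_le_exp, neg_le_neg_iff,
      show min d d₀ / 4 * N * ε ^ 2 = min d d₀ * N * (ε / 2) ^ 2 by ring]
    gcongr
  calc (P N).bind (κ N) {ω | ε ≤ |A' N ω - a|}
      ≤ ∫⁻ s, κ N s {ω | ε ≤ |A' N ω - a|} ∂P N := Measure.bind_apply_le _ hmeas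
    _ ≤ ∫⁻ s, (Set.indicator {s | ε / 2 ≤ |m N s - a|} 1 s +
        ENNReal.ofReal (2 * Real.exp (-(d₀ * N * (ε / 2) ^ 2)))) ∂P N := lintegral_mono_ae hpt
    _ = (∫⁻ s, Set.indicator {s | ε / 2 ≤ |m N s - a|} 1 s ∂P N) +
        ENNReal.ofReal (2 * Real.exp (-(d₀ * N * (ε / 2) ^ 2))) * P N Set.univ := by
      rw [lintegral_add_right _ measurable_const, lintegral_const]
    _ ≤ ENNReal.ofReal (c * Real.exp (-(d * N * (ε / 2) ^ 2))) +
        ENNReal.ofReal (2 * Real.exp (-(d₀ * N * (ε / 2) ^ 2))) := by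
      refine add_le_add ((lintegral_indicator_one_le _).trans (hm N hN _ (by positivity))) ?_
      exact mul_le_of_le_one_right' (hP N)
    _ ≤ ENNReal.ofReal ((c + 2) * Real.exp (-(min d d₀ / 4 * N * ε ^ 2))) := by
      rw [add_mul, ENNReal.ofReal_add (by positivity) (by positivity)]
      exact add_le_add
        (ENNReal.ofReal_le_ofReal (mul_le_mul_of_nonneg_left (hexp _ (min_le_left _ _)) hc.le))
        (ENNReal.ofReal_le_ofReal
          (mul_le_mul_of_nonneg_left (hexp _ (min_le_right _ _)) zero_le_two))

end Concentration

/-- Hoeffding's inequality for the empirical mean of an i.i.d. bounded sample. -/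
lemma pi_measure_abs_mean_sub_integral_ge_le {α : Type*} [MeasurableSpace α] (Q : Measure α)
    [IsProbabilityMeasure Q] {U : α → ℝ} (hU : Measurable U) {K : ℝ} (hK : 0 < K)
    (hUK : ∀ᵐ x ∂Q, |U x| ≤ K) {N : ℕ} (hN : 1 ≤ N) {ε : ℝ} (hε : 0 < ε) :
    Measure.pi (fun _ : Fin N => Q) {s | ε ≤ |(N : ℝ)⁻¹ * ∑ i, U (s i) - ∫ x, U x ∂Q|} ≤
      ENNReal.ofReal (2 * Real.exp (-(1 / (2 * K ^ 2) * N * ε ^ 2))) := by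
  set m := ∫ x, U x ∂Q
  set Pr := Measure.pi (fun _ : Fin N => Q)
  have hN' : (0 : ℝ) < N := by exact_mod_cast hN
  have hsub : HasSubgaussianMGF (fun x => U x - m) ((‖K - -K‖₊ / 2) ^ 2) Q :=
    hasSubgaussianMGF_of_mem_Icc hU.aemeasurable (by
      filter_upwards [hUK] with x hx using abs_le.1 hx)
  have hcK : (((‖K - -K‖₊ / 2) ^ 2 : NNReal) : ℝ) = K ^ 2 := by
    push_cast
    rw [Real.norm_of_nonneg (by linarith)]
    ring
  have key : ∀ V : α → ℝ, Measurable V → HasSubgaussianMGF V ((‖K - -K‖₊ / 2) ^ 2) Q →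
      Pr {s | N * ε ≤ ∑ i, V (s i)} ≤
        ENNReal.ofReal (Real.exp (-(1 / (2 * K ^ 2) * N * ε ^ 2))) := by
    intro V hV hVs
    have hind : iIndepFun (fun (i : Fin N) (s : Fin N → α) => V (s i)) Pr :=
      iIndepFun_pi (μ := fun _ : Fin N => Q) (X := fun _ => V) fun _ => hV.aemeasurable
    have hs : ∀ i ∈ (Finset.univ : Finset (Fin N)),
        HasSubgaussianMGF (fun s : Fin N → α => V (s i)) ((‖K - -K‖₊ / 2) ^ 2) Pr := by
      intro i _
      have hmp := measurePreserving_eval (fun _ : Fin N => Q) i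
      refine HasSubgaussianMGF.of_map (X := V) hmp.measurable.aemeasurable ?_
      rw [hmp.map_eq]
      exact hVs
    have h := HasSubgaussianMGF.measure_sum_ge_le_of_iIndepFun hind hs (ε := N * ε) (by positivity)
    rw [← ofReal_measureReal]
    refine ENNReal.ofReal_le_ofReal (h.trans_eq ?_)
    rw [Finset.sum_const, Finset.card_univ, Fintype.card_fin, nsmul_eq_mul, NNReal.coe_mul, hcK]
    congr 1
    push_cast
    field_simp
  have h1 := key _ (hU.sub_const m) hsub
  have h2 := key (fun x => -(U x - m)) (hU.sub_const m).neg hsub.neg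
  have hincl : {s : Fin N → α | ε ≤ |(N : ℝ)⁻¹ * ∑ i, U (s i) - m|} ⊆
      {s | N * ε ≤ ∑ i, (U (s i) - m)} ∪ {s | N * ε ≤ ∑ i, -(U (s i) - m)} := by
    intro s hs
    change ε ≤ _ at hs
    have hid : (N : ℝ) * ((N : ℝ)⁻¹ * ∑ i, U (s i) - m) = ∑ i, (U (s i) - m) := by
      rw [Finset.sum_sub_distrib, mul_sub, mul_inv_cancel_left₀ hN'.ne']
      simp
    rw [Set.mem_union, Set.mem_ofPred_eq, Set.mem_ofPred_eq, Finset.sum_neg_distrib, ← hid,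
      ← mul_neg, mul_le_mul_iff_right₀ hN', mul_le_mul_iff_right₀ hN']
    exact le_abs.1 hs
  refine (measure_mono hincl).trans ((measure_union_le _ _).trans ((add_le_add h1 h2).trans_eq ?_))
  rw [← ENNReal.ofReal_add (by positivity) (by positivity), ← two_mul]

section Normalize

variable {α β : Type*} [MeasurableSpace α] [MeasurableSpace β]

lemma normalize_univ_le_one (m : Measure α) : normalize m Set.univ ≤ 1 := by
  simp [normalize, ENNReal.inv_mul_le_one]

instance isFiniteMeasure_normalize (m : Measure α) : IsFiniteMeasure (normalize m) :=
  ⟨(normalize_univ_le_one m).trans_lt ENNReal.one_lt_top⟩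

lemma isProbabilityMeasure_normalize {m : Measure α} (h0 : m Set.univ ≠ 0)
    (ht : m Set.univ ≠ ⊤) : IsProbabilityMeasure (normalize m) :=
  ⟨by simpa [normalize] using ENNReal.inv_mul_cancel h0 ht⟩

lemma integral_normalize (m : Measure α) (g : α → ℝ) :
    ∫ x, g x ∂(normalize m) = (m Set.univ).toReal⁻¹ * ∫ x, g x ∂m := by
  rw [normalize, integral_smul_measure, ENNReal.toReal_inv, smul_eq_mul]

lemma ae_normalize {m : Measure α} {p : α → Prop} (h : ∀ᵐ x ∂m, p x) :
    ∀ᵐ x ∂(normalize m), p x :=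
  Measure.ae_smul_measure h _

lemma Measurable.normalize {m : α → Measure β} (hm : Measurable m) :
    Measurable fun a => PmParis.normalize (m a) := by
  refine Measure.measurable_of_measurable_coe _ fun A hA => ?_
  simp only [PmParis.normalize, Measure.smul_apply, smul_eq_mul]
  exact ((Measure.measurable_coe MeasurableSet.univ).comp hm).inv.mul
    ((Measure.measurable_coe hA).comp hm)

end Normalize

section MeasureValued

variable {α β γ : Type*} [MeasurableSpace α] [MeasurableSpace β] [MeasurableSpace γ]

lemma measurable_measure_pi_const {ι : Type*} [Fintype ι] {P : α → Measure β}
    [∀ a, IsFiniteMeasure (P a)] (hP : Measurable P) :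
    Measurable fun a => Measure.pi fun _ : ι => P a := by
  have h : ∀ s : ι → Set β, (∀ i, MeasurableSet (s i)) →
      Measurable fun a => Measure.pi (fun _ : ι => P a) (Set.univ.pi s) := by
    intro s hs
    simp only [Measure.pi_pi]
    exact Finset.measurable_fun_prod _ fun i _ => (Measure.measurable_coe (hs i)).comp hP
  refine Measurable.measure_of_isPiSystem generateFrom_pi.symm isPiSystem_pi ?_ ?_
  · rintro _ ⟨s, hs, rfl⟩
    exact h s fun i => hs i (Set.mem_univ i)
  · simpa using h (fun _ => Set.univ) fun _ => MeasurableSet.univ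

lemma measurable_map_dep {κ : α → Measure β} [∀ a, IsFiniteMeasure (κ a)] (hκ : Measurable κ)
    (hκ1 : ∀ a, κ a Set.univ ≤ 1) {g : α → β → γ} (hg : Measurable (Function.uncurry g)) :
    Measurable fun a => (κ a).map (g a) := by
  let K : Kernel α β := ⟨κ, hκ⟩
  have : IsFiniteKernel K := ⟨1, ENNReal.one_lt_top, hκ1⟩
  refine Measure.measurable_of_measurable_coe _ fun A hA => ?_
  have : ∀ a, (κ a).map (g a) A = K a (Prod.mk a ⁻¹' (Function.uncurry g ⁻¹' A)) := fun a => by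
    rw [Measure.map_apply (f := g a) (hg.comp (measurable_prodMk_left (x := a))) hA]
    rfl
  simp only [this]
  exact Kernel.measurable_kernel_prodMk_left (hg hA)

lemma measurable_measure_prod {κ : α → Measure β} {η : α → Measure γ}
    [∀ a, IsFiniteMeasure (κ a)] [∀ a, IsFiniteMeasure (η a)] (hκ : Measurable κ)
    (hη : Measurable η) : Measurable fun a => (κ a).prod (η a) := by
  have h : ∀ s t, MeasurableSet s → MeasurableSet t →
      Measurable fun a => (κ a).prod (η a) (s ×ˢ t) := by
    intro s t hs ht
    simp only [Measure.prod_prod]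
    exact ((Measure.measurable_coe hs).comp hκ).mul ((Measure.measurable_coe ht).comp hη)
  refine Measurable.measure_of_isPiSystem generateFrom_prod.symm isPiSystem_prod ?_ ?_
  · rintro _ ⟨s, hs, t, ht, rfl⟩
    exact h s t hs ht
  · simpa using h _ _ MeasurableSet.univ MeasurableSet.univ

lemma integral_bind_of_measurable {m : Measure α} [SFinite m] {κ : α → Measure β}
    (hκ : Measurable κ) [∀ a, IsProbabilityMeasure (κ a)] {g : β → ℝ}
    (hg : Integrable g (m.bind κ)) : ∫ y, g y ∂(m.bind κ) = ∫ a, ∫ y, g y ∂(κ a) ∂m := by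
  let K : Kernel α β := ⟨κ, hκ⟩
  have : IsMarkovKernel K := ⟨fun a => inferInstanceAs (IsProbabilityMeasure (κ a))⟩
  have hsnd : m.bind κ = (m.compProd K).map Prod.snd := (Measure.snd_compProd m K).symm
  rw [hsnd] at hg ⊢
  rw [integral_map measurable_snd.aemeasurable hg.1,
    Measure.integral_compProd (f := fun p => g p.2) (hg.comp_measurable measurable_snd)]
  rfl

lemma ae_bind_of_forall {m : Measure α} {κ : α → Measure β} {p : β → Prop}
    (hp : MeasurableSet {b | p b}) (h : ∀ᵐ a ∂m, ∀ᵐ b ∂(κ a), p b) :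
    ∀ᵐ b ∂(m.bind κ), p b := by
  rw [ae_iff, ← nonpos_iff_eq_zero]
  refine (Measure.bind_apply_le κ (s := {b | ¬ p b}) hp.compl).trans ?_
  rw [nonpos_iff_eq_zero, lintegral_eq_zero_of_ae_eq_zero]
  filter_upwards [h] with a ha using ha

end MeasureValued

/-- The standing regularity assumptions on the model, with a common bound `C` on the importance
weights `ℓ̂ / (ϑ p)`. -/
structure IsRegularModel (μ : ∀ n, Measure (X n)) (R : ∀ k, Kernel (X k × X (k + 1)) (Z k))
    (lhat : ∀ k, X k → X (k + 1) → Z k → ℝ) (htil : ∀ k, X k → X (k + 1) → ℝ)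
    (ϑ : ∀ k, X k → ℝ) (pr : ∀ k, X k → X (k + 1) → ℝ) (C : ℝ) : Prop where
  measurable_lhat : ∀ k, Measurable fun q : (X k × X (k + 1)) × Z k => lhat k q.1.1 q.1.2 q.2
  lhat_pos : ∀ k x y z, 0 < lhat k x y z
  measurable_adj : ∀ k, Measurable (ϑ k)
  adj_pos : ∀ k x, 0 < ϑ k x
  adj_bdd : ∀ k, ∃ D, ∀ x, ϑ k x ≤ D
  measurable_prop : ∀ k, Measurable fun q : X k × X (k + 1) => pr k q.1 q.2
  prop_pos : ∀ k x y, 0 < pr k x y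
  lintegral_prop : ∀ k x, ∫⁻ y, ENNReal.ofReal (pr k x y) ∂μ (k + 1) = 1
  weight_le : ∀ k x y z, lhat k x y z / (ϑ k x * pr k x y) ≤ C
  measurable_htil : ∀ k, Measurable fun q : X k × X (k + 1) => htil k q.1 q.2
  htil_bdd : ∀ k, ∃ D, ∀ x y, |htil k x y| ≤ D
  bound_pos : 0 < C

namespace IsRegularModel

variable {μ : ∀ n, Measure (X n)} {R : ∀ k, Kernel (X k × X (k + 1)) (Z k)}
  {lhat : ∀ k, X k → X (k + 1) → Z k → ℝ} {htil : ∀ k, X k → X (k + 1) → ℝ}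
  {ϑ : ∀ k, X k → ℝ} {pr : ∀ k, X k → X (k + 1) → ℝ} {C : ℝ}

section Density

variable (hm : IsRegularModel μ R lhat htil ϑ pr C)
include hm

lemma lhat_le (k : ℕ) (x : X k) (y : X (k + 1)) (z : Z k) :
    lhat k x y z ≤ C * (ϑ k x * pr k x y) :=
  (div_le_iff₀ (mul_pos (hm.adj_pos k x) (hm.prop_pos k x y))).1 (hm.weight_le k x y z)

lemma measurable_lhat_aux (k : ℕ) (x : X k) (y : X (k + 1)) :
    Measurable fun z => lhat k x y z :=
  (hm.measurable_lhat k).comp (measurable_prodMk_left (x := (x, y)))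

lemma measurable_prop_right (k : ℕ) (x : X k) : Measurable (pr k x) :=
  (hm.measurable_prop k).comp measurable_prodMk_left

lemma integrable_prop (k : ℕ) (x : X k) : Integrable (pr k x) (μ (k + 1)) := by
  rw [← lintegral_ofReal_ne_top_iff_integrable (hm.measurable_prop_right k x).aestronglyMeasurable
    (Eventually.of_forall fun y => (hm.prop_pos k x y).le), hm.lintegral_prop]
  exact ENNReal.one_ne_top

lemma integral_prop (k : ℕ) (x : X k) : ∫ y, pr k x y ∂μ (k + 1) = 1 := by
  rw [integral_eq_lintegral_of_nonneg_ae (Eventually.of_forall fun y => (hm.prop_pos k x y).le)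
    (hm.measurable_prop_right k x).aestronglyMeasurable, hm.lintegral_prop, ENNReal.toReal_one]

variable [∀ k, IsMarkovKernel (R k)]

lemma integrable_lhat (k : ℕ) (x : X k) (y : X (k + 1)) :
    Integrable (fun z => lhat k x y z) (R k (x, y)) :=
  Integrable.of_bound (hm.measurable_lhat_aux k x y).aestronglyMeasurable
    (C * (ϑ k x * pr k x y)) (Eventually.of_forall fun z => by
      rw [Real.norm_of_nonneg (hm.lhat_pos k x y z).le]
      exact hm.lhat_le k x y z)

lemma lEps_pos (k : ℕ) (x : X k) (y : X (k + 1)) : 0 < lEps R lhat k x y := by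
  have hsupp : Function.support (fun z => lhat k x y z) = Set.univ :=
    Set.eq_univ_of_forall fun z => (hm.lhat_pos k x y z).ne'
  rw [lEps, integral_pos_iff_support_of_nonneg (fun z => (hm.lhat_pos k x y z).le)
    (hm.integrable_lhat k x y), hsupp, measure_univ]
  exact one_pos

lemma lEps_le (k : ℕ) (x : X k) (y : X (k + 1)) :
    lEps R lhat k x y ≤ C * (ϑ k x * pr k x y) := by
  have h := integral_mono (hm.integrable_lhat k x y) (integrable_const _) (hm.lhat_le k x y)
  simpa [lEps] using h

lemma measurable_lEps (k : ℕ) :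
    Measurable fun q : X k × X (k + 1) => lEps R lhat k q.1 q.2 :=
  (StronglyMeasurable.integral_kernel_prod_right' (κ := R k)
    (hm.measurable_lhat k).stronglyMeasurable).measurable

lemma measurable_lEps_right (k : ℕ) (x : X k) : Measurable (lEps R lhat k x) :=
  (hm.measurable_lEps k).comp measurable_prodMk_left

lemma integrable_lEps_mul (k : ℕ) (x : X k) {g : X (k + 1) → ℝ} (hg : Measurable g) {D : ℝ}
    (hD : ∀ y, |g y| ≤ D) : Integrable (fun y => lEps R lhat k x y * g y) (μ (k + 1)) := by
  refine Integrable.mul_bdd (c := D) ?_ hg.aestronglyMeasurable (Eventually.of_forall hD)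
  refine ((hm.integrable_prop k x).const_mul (C * ϑ k x)).mono'
    (hm.measurable_lEps_right k x).aestronglyMeasurable (Eventually.of_forall fun y => ?_)
  rw [Real.norm_of_nonneg (hm.lEps_pos k x y).le, mul_assoc]
  exact hm.lEps_le k x y

lemma abs_integral_lEps_mul_le (k : ℕ) (x : X k) {g : X (k + 1) → ℝ} {D : ℝ}
    (hD : ∀ y, |g y| ≤ D) :
    |∫ y, lEps R lhat k x y * g y ∂μ (k + 1)| ≤ D * C * ϑ k x := by
  have hint : Integrable (fun y => D * C * ϑ k x * pr k x y) (μ (k + 1)) :=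
    (hm.integrable_prop k x).const_mul _
  have h := norm_integral_le_of_norm_le (f := fun y => lEps R lhat k x y * g y) hint
    (Eventually.of_forall fun y => ?_)
  · rw [integral_const_mul, hm.integral_prop, mul_one] at h
    exact h
  · rw [norm_mul, Real.norm_of_nonneg (hm.lEps_pos k x y).le, Real.norm_eq_abs]
    calc lEps R lhat k x y * |g y| ≤ C * (ϑ k x * pr k x y) * D :=
          mul_le_mul (hm.lEps_le k x y) (hD y) (abs_nonneg _)
            ((hm.lEps_pos k x y).le.trans (hm.lEps_le k x y))
      _ = D * C * ϑ k x * pr k x y := by ring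

end Density

end IsRegularModel

namespace IsRegularModel

variable {μ : ∀ n, Measure (X n)} {R : ∀ k, Kernel (X k × X (k + 1)) (Z k)}
  {lhat : ∀ k, X k → X (k + 1) → Z k → ℝ} {htil : ∀ k, X k → X (k + 1) → ℝ}
  {ϑ : ∀ k, X k → ℝ} {pr : ∀ k, X k → X (k + 1) → ℝ} {C : ℝ}

section Backward

/-- Unnormalised version of `bwdMeas`. -/
noncomputable def bwdRaw (R : ∀ k, Kernel (X k × X (k + 1)) (Z k))
    (lhat : ∀ k, X k → X (k + 1) → Z k → ℝ) {N : ℕ} (n : ℕ)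
    (s : PState X N n) (x' : X (n + 1)) : Measure (Fin N × Z n) :=
  Measure.sum fun j : Fin N =>
    (((R n ((s j).1, x')).withDensity fun z =>
        ENNReal.ofReal ((s j).2.2 * lhat n (s j).1 x' z)).map fun z => (j, z))

variable (hm : IsRegularModel μ R lhat htil ϑ pr C) [∀ k, IsMarkovKernel (R k)]
  {N n M : ℕ} {s : PState X N n}
include hm

lemma lintegral_ofReal_mul_lhat (x : X n) (x' : X (n + 1)) {w : ℝ} (hw : 0 ≤ w) :
    ∫⁻ z, ENNReal.ofReal (w * lhat n x x' z) ∂(R n (x, x')) =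
      ENNReal.ofReal (w * lEps R lhat n x x') := by
  rw [lEps, ← integral_const_mul, ofReal_integral_eq_lintegral_ofReal
    ((hm.integrable_lhat n x x').const_mul w)
    (Eventually.of_forall fun z => mul_nonneg hw (hm.lhat_pos n x x' z).le)]

lemma bwdRaw_univ (hω : ∀ i, 0 ≤ (s i).2.2) (x' : X (n + 1)) :
    bwdRaw R lhat n s x' Set.univ =
      ENNReal.ofReal (∑ j, (s j).2.2 * lEps R lhat n (s j).1 x') := by
  rw [bwdRaw, Measure.sum_apply _ MeasurableSet.univ, tsum_fintype,
    ENNReal.ofReal_sum_of_nonneg fun j _ => mul_nonneg (hω j) (hm.lEps_pos n _ x').le]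
  refine Finset.sum_congr rfl fun j _ => ?_
  rw [Measure.map_apply measurable_prodMk_left MeasurableSet.univ, Set.preimage_univ,
    withDensity_apply _ MeasurableSet.univ, Measure.restrict_univ,
    hm.lintegral_ofReal_mul_lhat _ _ (hω j)]

lemma integral_bwdRaw (hω : ∀ i, 0 ≤ (s i).2.2) (x' : X (n + 1)) (G : Fin N → ℝ) :
    ∫ q, G q.1 ∂(bwdRaw R lhat n s x') =
      ∑ j, (s j).2.2 * lEps R lhat n (s j).1 x' * G j := by
  have hfin : ∀ j, IsFiniteMeasure ((R n ((s j).1, x')).withDensity fun z =>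
      ENNReal.ofReal ((s j).2.2 * lhat n (s j).1 x' z)) := fun j =>
    isFiniteMeasure_withDensity (by
      rw [hm.lintegral_ofReal_mul_lhat _ _ (hω j)]
      exact ENNReal.ofReal_ne_top)
  have hG : Measurable fun q : Fin N × Z n => G q.1 :=
    (measurable_of_finite G).comp measurable_fst
  rw [bwdRaw, Measure.sum_fintype, integral_finsetSum_measure]
  · refine Finset.sum_congr rfl fun j _ => ?_
    rw [integral_map measurable_prodMk_left.aemeasurable hG.aestronglyMeasurable]
    simp only [integral_const, smul_eq_mul]
    rw [Measure.real, withDensity_apply _ MeasurableSet.univ, Measure.restrict_univ,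
      hm.lintegral_ofReal_mul_lhat _ _ (hω j),
      ENNReal.toReal_ofReal (mul_nonneg (hω j) (hm.lEps_pos n _ x').le)]
  · intro j _
    rw [integrable_map_measure hG.aestronglyMeasurable measurable_prodMk_left.aemeasurable]
    exact integrable_const (μ := (R n ((s j).1, x')).withDensity fun z =>
      ENNReal.ofReal ((s j).2.2 * lhat n (s j).1 x' z)) (G j)

lemma measurable_bwdRaw : Measurable (bwdRaw R lhat n s) := by
  refine Measure.measurable_of_measurable_coe _ fun A hA => ?_
  simp only [bwdRaw, Measure.sum_apply _ hA, tsum_fintype]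
  refine Finset.measurable_fun_sum _ fun j _ => ?_
  have hpre : MeasurableSet ((fun z : Z n => (j, z)) ⁻¹' A) := measurable_prodMk_left hA
  simp only [Measure.map_apply measurable_prodMk_left hA, withDensity_apply _ hpre]
  have hg : Measurable fun x' : X (n + 1) => ((s j).1, x') := measurable_prodMk_left
  refine Measurable.setLIntegral_kernel_prod_right
    (κ := (R n).comap (fun x' => ((s j).1, x')) hg)
    (f := fun x' z => ENNReal.ofReal ((s j).2.2 * lhat n (s j).1 x' z)) ?_ hpre
  exact (((hm.measurable_lhat n).comp
    ((hg.comp measurable_fst).prodMk measurable_snd)).const_mul _).ennreal_ofReal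

lemma sum_mul_lEps_pos (hω : ∀ i, 0 ≤ (s i).2.2) (hpos : 0 < ∑ i, (s i).2.2) (x' : X (n + 1)) :
    0 < ∑ j, (s j).2.2 * lEps R lhat n (s j).1 x' := by
  obtain ⟨j, hj, hjpos⟩ := Finset.exists_lt_of_sum_lt (s := Finset.univ)
    (f := fun _ => (0 : ℝ)) (g := fun i => (s i).2.2) (by simpa using hpos)
  exact Finset.sum_pos' (fun i _ => mul_nonneg (hω i) (hm.lEps_pos n _ x').le)
    ⟨j, hj, mul_pos hjpos (hm.lEps_pos n _ x')⟩

lemma isProbabilityMeasure_bwdMeas (hω : ∀ i, 0 ≤ (s i).2.2) (hpos : 0 < ∑ i, (s i).2.2)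
    (x' : X (n + 1)) : IsProbabilityMeasure (bwdMeas R lhat n s x') := by
  refine isProbabilityMeasure_normalize (m := bwdRaw R lhat n s x') ?_ ?_
  · rw [hm.bwdRaw_univ hω]
    exact (ENNReal.ofReal_pos.2 (hm.sum_mul_lEps_pos hω hpos x')).ne'
  · rw [hm.bwdRaw_univ hω]
    exact ENNReal.ofReal_ne_top

lemma integral_bwdMeas (hω : ∀ i, 0 ≤ (s i).2.2) (x' : X (n + 1)) (G : Fin N → ℝ) :
    ∫ q, G q.1 ∂(bwdMeas R lhat n s x') =
      (∑ j, (s j).2.2 * lEps R lhat n (s j).1 x')⁻¹ *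
        ∑ j, (s j).2.2 * lEps R lhat n (s j).1 x' * G j := by
  change ∫ q, G q.1 ∂(normalize (bwdRaw R lhat n s x')) = _
  rw [integral_normalize, hm.integral_bwdRaw hω, hm.bwdRaw_univ hω, ENNReal.toReal_ofReal]
  exact Finset.sum_nonneg fun j _ => mul_nonneg (hω j) (hm.lEps_pos n _ x').le

lemma measurable_bwdMeas : Measurable (bwdMeas R lhat n s) :=
  Measurable.normalize (hm.measurable_bwdRaw (s := s))

end Backward

section BackwardStatistic

variable {N n M : ℕ} {s : PState X N n}

instance isFiniteMeasure_bwdMeas (x' : X (n + 1)) : IsFiniteMeasure (bwdMeas R lhat n s x') :=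
  isFiniteMeasure_normalize _

omit [∀ n, MeasurableSpace (X n)] in
lemma measurable_backwardStatistic (htil : ∀ k, X k → X (k + 1) → ℝ) (x' : X (n + 1)) :
    Measurable fun J : Fin M → Fin N × Z n =>
      (M : ℝ)⁻¹ * ∑ j : Fin M, ((s (J j).1).2.1 + htil n (s (J j).1).1 x') := by
  have hG : Measurable fun j : Fin N => (s j).2.1 + htil n (s j).1 x' := measurable_of_finite _
  exact (Finset.measurable_fun_sum _ fun j _ =>
    hG.comp (measurable_fst.comp (measurable_pi_apply j))).const_mul _

omit [∀ n, MeasurableSpace (X n)] [∀ n, MeasurableSpace (Z n)] in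
lemma abs_backwardStatistic_le (hM : 1 ≤ M) {K D : ℝ} (hτ : ∀ i, |(s i).2.1| ≤ K)
    (hD : ∀ x y, |htil n x y| ≤ D) (x' : X (n + 1)) (J : Fin M → Fin N × Z n) :
    |(M : ℝ)⁻¹ * ∑ j : Fin M, ((s (J j).1).2.1 + htil n (s (J j).1).1 x')| ≤ K + D := by
  have hM' : (0 : ℝ) < M := by exact_mod_cast hM
  rw [abs_mul, abs_of_pos (inv_pos.2 hM'), inv_mul_le_iff₀ hM']
  refine (Finset.abs_sum_le_sum_abs _ _).trans ?_
  refine (Finset.sum_le_card_nsmul _ _ (K + D) fun j _ => ?_).trans_eq (by simp [mul_add])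
  exact (abs_add_le _ _).trans (add_le_add (hτ _) (hD _ _))

lemma ae_bsLaw_abs_le (hM : 1 ≤ M) {K D : ℝ} (hτ : ∀ i, |(s i).2.1| ≤ K)
    (hD : ∀ x y, |htil n x y| ≤ D) (x' : X (n + 1)) :
    ∀ᵐ t ∂(bsLaw R lhat htil M n s x'), |t| ≤ K + D := by
  rw [bsLaw, ae_map_iff (measurable_backwardStatistic htil x').aemeasurable
    (measurableSet_le measurable_id'.abs measurable_const)]
  exact Eventually.of_forall (abs_backwardStatistic_le hM hτ hD x')

variable (hm : IsRegularModel μ R lhat htil ϑ pr C) [∀ k, IsMarkovKernel (R k)]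
include hm

lemma isProbabilityMeasure_bsLaw (hω : ∀ i, 0 ≤ (s i).2.2) (hpos : 0 < ∑ i, (s i).2.2)
    (x' : X (n + 1)) : IsProbabilityMeasure (bsLaw R lhat htil M n s x') := by
  have := hm.isProbabilityMeasure_bwdMeas hω hpos x'
  exact Measure.isProbabilityMeasure_map (measurable_backwardStatistic htil x').aemeasurable

lemma integral_bsLaw (hM : 1 ≤ M) (hω : ∀ i, 0 ≤ (s i).2.2) (hpos : 0 < ∑ i, (s i).2.2)
    (x' : X (n + 1)) :
    ∫ t, t ∂(bsLaw R lhat htil M n s x') =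
      (∑ j, (s j).2.2 * lEps R lhat n (s j).1 x')⁻¹ *
        ∑ j, (s j).2.2 * lEps R lhat n (s j).1 x' * ((s j).2.1 + htil n (s j).1 x') := by
  have := hm.isProbabilityMeasure_bwdMeas hω hpos x'
  have hM' : (M : ℝ) ≠ 0 := by exact_mod_cast (by omega : M ≠ 0)
  let G : Fin N → ℝ := fun j => (s j).2.1 + htil n (s j).1 x'
  have hG : Measurable fun q : Fin N × Z n => G q.1 :=
    (measurable_of_finite G).comp measurable_fst
  have hGint : Integrable (fun q : Fin N × Z n => G q.1) (bwdMeas R lhat n s x') :=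
    Integrable.of_bound hG.aestronglyMeasurable (∑ j, |G j|) (Eventually.of_forall fun q =>
      Finset.single_le_sum (f := fun j => |G j|) (fun j _ => abs_nonneg _) (Finset.mem_univ q.1))
  have hmp := fun j : Fin M =>
    measurePreserving_eval (fun _ : Fin M => bwdMeas R lhat n s x') j
  rw [bsLaw, integral_map (measurable_backwardStatistic htil x').aemeasurable
    measurable_id'.aestronglyMeasurable, integral_const_mul]
  have hj : ∀ j : Fin M,
      ∫ J, G (J j).1 ∂(Measure.pi fun _ : Fin M => bwdMeas R lhat n s x') =
        ∫ q, G q.1 ∂(bwdMeas R lhat n s x') := fun j => by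
    have h := integral_map (μ := Measure.pi fun _ : Fin M => bwdMeas R lhat n s x')
      (hmp j).measurable.aemeasurable
      (f := fun q : Fin N × Z n => G q.1) hG.aestronglyMeasurable
    rw [(hmp j).map_eq] at h
    exact h.symm
  change (M : ℝ)⁻¹ *
    ∫ J, ∑ j : Fin M, G (J j).1 ∂(Measure.pi fun _ : Fin M => bwdMeas R lhat n s x') = _
  rw [integral_finsetSum (f := fun (j : Fin M) (J : Fin M → Fin N × Z n) => G (J j).1) _
      fun j _ => (hmp j).integrable_comp_of_integrable hGint,
    Finset.sum_congr rfl fun j _ => hj j, hm.integral_bwdMeas hω]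
  simp [G, hM']

lemma measurable_bsLaw : Measurable (bsLaw R lhat htil M n s) := by
  refine measurable_map_dep (κ := fun x' => Measure.pi fun _ : Fin M => bwdMeas R lhat n s x')
    (g := fun x' J => (M : ℝ)⁻¹ * ∑ j : Fin M, ((s (J j).1).2.1 + htil n (s (J j).1).1 x'))
    (measurable_measure_pi_const hm.measurable_bwdMeas) (fun x' => ?_) ?_
  · rw [Measure.pi_univ]
    exact Finset.prod_le_one' fun _ _ => normalize_univ_le_one _
  · have hG : Measurable fun q : X (n + 1) × Fin N => (s q.2).2.1 + htil n (s q.2).1 q.1 := by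
      refine measurable_from_prod_countable_left fun j => ?_
      exact ((hm.measurable_htil n).comp (measurable_prodMk_left (x := (s j).1))).const_add
        (s j).2.1
    refine (Finset.measurable_fun_sum _ fun j _ => ?_).const_mul _
    exact hG.comp (measurable_fst.prodMk
      (measurable_fst.comp ((measurable_pi_apply j).comp measurable_snd)))

end BackwardStatistic

end IsRegularModel

/-- Law of a new particle triple `(x', τ', ω')` at position `x'`, given that its ancestor is
located at `x`. -/
noncomputable def offspringLaw (R : ∀ k, Kernel (X k × X (k + 1)) (Z k))
    (lhat : ∀ k, X k → X (k + 1) → Z k → ℝ) (htil : ∀ k, X k → X (k + 1) → ℝ)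
    (ϑ : ∀ k, X k → ℝ) (pr : ∀ k, X k → X (k + 1) → ℝ) {N : ℕ} (M n : ℕ)
    (s : PState X N n) (x : X n) (x' : X (n + 1)) : Measure (X (n + 1) × ℝ × ℝ) :=
  ((bsLaw R lhat htil M n s x').prod
      ((R n (x, x')).map fun z => lhat n x x' z / (ϑ n x * pr n x x'))).map
    fun q => (x', q.1, q.2)

/-- Law of the position of a particle proposed from `x`. -/
noncomputable def propLaw (μ : ∀ n, Measure (X n)) (pr : ∀ k, X k → X (k + 1) → ℝ) (n : ℕ)
    (x : X n) : Measure (X (n + 1)) :=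
  (μ (n + 1)).withDensity fun y => ENNReal.ofReal (pr n x y)

/-- Unnormalised version of `partLaw`. -/
noncomputable def partRaw (μ : ∀ n, Measure (X n)) (R : ∀ k, Kernel (X k × X (k + 1)) (Z k))
    (lhat : ∀ k, X k → X (k + 1) → Z k → ℝ) (htil : ∀ k, X k → X (k + 1) → ℝ)
    (ϑ : ∀ k, X k → ℝ) (pr : ∀ k, X k → X (k + 1) → ℝ) {N : ℕ} (M n : ℕ)
    (s : PState X N n) : Measure (X (n + 1) × ℝ × ℝ) :=
  Measure.sum fun i : Fin N => ENNReal.ofReal (ϑ n (s i).1 * (s i).2.2) •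
    (propLaw μ pr n (s i).1).bind (offspringLaw R lhat htil ϑ pr M n s (s i).1)

lemma partLaw_eq_normalize (μ : ∀ n, Measure (X n)) (R : ∀ k, Kernel (X k × X (k + 1)) (Z k))
    (lhat : ∀ k, X k → X (k + 1) → Z k → ℝ) (htil : ∀ k, X k → X (k + 1) → ℝ)
    (ϑ : ∀ k, X k → ℝ) (pr : ∀ k, X k → X (k + 1) → ℝ) {N : ℕ} (M n : ℕ)
    (s : PState X N n) :
    partLaw μ R lhat htil ϑ pr M n s = normalize (partRaw μ R lhat htil ϑ pr M n s) :=
  rfl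

namespace IsRegularModel

variable {μ : ∀ n, Measure (X n)} {R : ∀ k, Kernel (X k × X (k + 1)) (Z k)}
  {lhat : ∀ k, X k → X (k + 1) → Z k → ℝ} {htil : ∀ k, X k → X (k + 1) → ℝ}
  {ϑ : ∀ k, X k → ℝ} {pr : ∀ k, X k → X (k + 1) → ℝ} {C : ℝ}
  {N n M : ℕ} {s : PState X N n}

section Offspring

instance isFiniteMeasure_bsLaw (x' : X (n + 1)) :
    IsFiniteMeasure (bsLaw R lhat htil M n s x') := by
  rw [bsLaw]
  infer_instance

lemma bsLaw_univ_le_one (x' : X (n + 1)) : bsLaw R lhat htil M n s x' Set.univ ≤ 1 := by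
  rw [bsLaw, Measure.map_apply (measurable_backwardStatistic htil x') MeasurableSet.univ,
    Set.preimage_univ, Measure.pi_univ]
  exact Finset.prod_le_one' fun _ _ => normalize_univ_le_one _

variable (hm : IsRegularModel μ R lhat htil ϑ pr C) [∀ k, IsMarkovKernel (R k)]
include hm

omit [∀ k, IsMarkovKernel (R k)] in
lemma measurable_weight (x : X n) (x' : X (n + 1)) :
    Measurable fun z => lhat n x x' z / (ϑ n x * pr n x x') :=
  (hm.measurable_lhat_aux n x x').div_const _

lemma isProbabilityMeasure_offspringLaw (hω : ∀ i, 0 ≤ (s i).2.2)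
    (hpos : 0 < ∑ i, (s i).2.2) (x : X n) (x' : X (n + 1)) :
    IsProbabilityMeasure (offspringLaw R lhat htil ϑ pr M n s x x') := by
  have := hm.isProbabilityMeasure_bsLaw (M := M) hω hpos x'
  have := Measure.isProbabilityMeasure_map (μ := R n (x, x'))
    (hm.measurable_weight x x').aemeasurable
  exact Measure.isProbabilityMeasure_map (by fun_prop)

lemma measurable_offspringLaw (x : X n) :
    Measurable (offspringLaw R lhat htil ϑ pr M n s x) := by
  refine measurable_map_dep (κ := fun x' => (bsLaw R lhat htil M n s x').prod
      ((R n (x, x')).map fun z => lhat n x x' z / (ϑ n x * pr n x x')))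
    (g := fun x' q => (x', q.1, q.2)) ?_ (fun x' => ?_) (by fun_prop)
  · refine measurable_measure_prod hm.measurable_bsLaw
      (measurable_map_dep (κ := fun x' => R n (x, x'))
        (g := fun x' z => lhat n x x' z / (ϑ n x * pr n x x'))
        ((R n).measurable.comp measurable_prodMk_left) (fun x' => prob_le_one) ?_)
    have h : Measurable fun q : X (n + 1) × Z n => ((x, q.1), q.2) := by fun_prop
    exact ((hm.measurable_lhat n).comp h).div
      (((hm.measurable_prop_right n x).comp measurable_fst).const_mul _)
  · rw [Measure.prod_apply MeasurableSet.univ]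
    have := Measure.isProbabilityMeasure_map (μ := R n (x, x'))
      (hm.measurable_weight x x').aemeasurable
    simpa using bsLaw_univ_le_one x'

omit [∀ k, IsMarkovKernel (R k)] in
lemma ae_offspringLaw_bound (hM : 1 ≤ M) {K D : ℝ} (hτ : ∀ i, |(s i).2.1| ≤ K)
    (hD : ∀ x y, |htil n x y| ≤ D) (x : X n) (x' : X (n + 1)) :
    ∀ᵐ p ∂(offspringLaw R lhat htil ϑ pr M n s x x'),
      |p.2.1| ≤ K + D ∧ 0 ≤ p.2.2 ∧ p.2.2 ≤ C := by
  have hw := hm.measurable_weight x x'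
  rw [offspringLaw, ae_map_iff (by fun_prop) (by measurability)]
  have h1 := Measure.quasiMeasurePreserving_fst
    (ν := (R n (x, x')).map fun z => lhat n x x' z / (ϑ n x * pr n x x')).ae
    (ae_bsLaw_abs_le (R := R) (lhat := lhat) hM hτ hD x')
  have h2 : ∀ᵐ w ∂((R n (x, x')).map fun z => lhat n x x' z / (ϑ n x * pr n x x')),
      0 ≤ w ∧ w ≤ C := by
    rw [ae_map_iff hw.aemeasurable (by measurability)]
    exact Eventually.of_forall fun z => ⟨(div_pos (hm.lhat_pos n x x' z)
      (mul_pos (hm.adj_pos n x) (hm.prop_pos n x x'))).le, hm.weight_le n x x' z⟩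
  have h3 := Measure.quasiMeasurePreserving_snd
    (μ := bsLaw R lhat htil M n s x').ae h2
  filter_upwards [h1, h3] with q hq1 hq2 using ⟨hq1, hq2⟩

lemma integral_offspringLaw (hM : 1 ≤ M) (hω : ∀ i, 0 ≤ (s i).2.2)
    (hpos : 0 < ∑ i, (s i).2.2) {K : ℝ} (hτ : ∀ i, |(s i).2.1| ≤ K)
    {f ft : X (n + 1) → ℝ} (hf : Measurable f) (hft : Measurable ft)
    (x : X n) (x' : X (n + 1)) :
    ∫ p, p.2.2 * (p.2.1 * f p.1 + ft p.1) ∂(offspringLaw R lhat htil ϑ pr M n s x x') =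
      lEps R lhat n x x' / (ϑ n x * pr n x x') *
        ((∫ t, t ∂(bsLaw R lhat htil M n s x')) * f x' + ft x') := by
  obtain ⟨D, hD⟩ := hm.htil_bdd n
  have := hm.isProbabilityMeasure_bsLaw (M := M) hω hpos x'
  have hint : Integrable (fun t : ℝ => t) (bsLaw R lhat htil M n s x') :=
    Integrable.of_bound measurable_id'.aestronglyMeasurable (K + D)
      (ae_bsLaw_abs_le hM hτ hD x')
  rw [offspringLaw, integral_map (by fun_prop) (by
    have h1 := hf.comp (measurable_fst : Measurable (Prod.fst : X (n + 1) × ℝ × ℝ → X (n + 1)))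
    have h2 := hft.comp (measurable_fst : Measurable (Prod.fst : X (n + 1) × ℝ × ℝ → X (n + 1)))
    exact (measurable_snd.snd.mul ((measurable_snd.fst.mul h1).add h2)).aestronglyMeasurable)]
  simp only [mul_comm (_ : ℝ) (_ + _ : ℝ)]
  rw [integral_prod_mul (fun t : ℝ => t * f x' + ft x') (fun w : ℝ => w),
    integral_map (hm.measurable_weight x x').aemeasurable
      measurable_id'.aestronglyMeasurable, integral_div,
    integral_add (hint.mul_const _) (integrable_const _), integral_mul_const]
  simp [lEps]

end Offspring

section PartLaw

variable (hm : IsRegularModel μ R lhat htil ϑ pr C) [∀ k, IsMarkovKernel (R k)]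
include hm

omit [∀ k, IsMarkovKernel (R k)] in
lemma isProbabilityMeasure_propLaw (x : X n) : IsProbabilityMeasure (propLaw μ pr n x) :=
  ⟨by rw [propLaw, withDensity_apply _ MeasurableSet.univ, Measure.restrict_univ,
    hm.lintegral_prop]⟩

lemma isProbabilityMeasure_bind_offspringLaw (hω : ∀ i, 0 ≤ (s i).2.2)
    (hpos : 0 < ∑ i, (s i).2.2) (x : X n) :
    IsProbabilityMeasure
      ((propLaw μ pr n x).bind (offspringLaw R lhat htil ϑ pr M n s x)) := by
  have := hm.isProbabilityMeasure_propLaw x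
  have := hm.isProbabilityMeasure_offspringLaw (M := M) hω hpos x
  exact ⟨by rw [Measure.bind_apply MeasurableSet.univ (hm.measurable_offspringLaw x).aemeasurable]
            simp⟩

lemma partRaw_univ (hω : ∀ i, 0 ≤ (s i).2.2) (hpos : 0 < ∑ i, (s i).2.2) :
    partRaw μ R lhat htil ϑ pr M n s Set.univ =
      ENNReal.ofReal (∑ i, (s i).2.2 * ϑ n (s i).1) := by
  have := fun x => hm.isProbabilityMeasure_bind_offspringLaw (M := M) hω hpos x
  rw [partRaw, Measure.sum_apply _ MeasurableSet.univ, tsum_fintype,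
    ENNReal.ofReal_sum_of_nonneg fun j _ => mul_nonneg (hω j) (hm.adj_pos n _).le]
  simp [mul_comm]

omit [∀ k, IsMarkovKernel (R k)] in
lemma sum_mul_adj_pos (hω : ∀ i, 0 ≤ (s i).2.2) (hpos : 0 < ∑ i, (s i).2.2) :
    0 < ∑ i, (s i).2.2 * ϑ n (s i).1 := by
  obtain ⟨j, hj, hjpos⟩ := Finset.exists_lt_of_sum_lt (s := Finset.univ)
    (f := fun _ => (0 : ℝ)) (g := fun i => (s i).2.2) (by simpa using hpos)
  exact Finset.sum_pos' (fun i _ => mul_nonneg (hω i) (hm.adj_pos n _).le)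
    ⟨j, hj, mul_pos hjpos (hm.adj_pos n _)⟩

lemma isProbabilityMeasure_partLaw (hω : ∀ i, 0 ≤ (s i).2.2) (hpos : 0 < ∑ i, (s i).2.2) :
    IsProbabilityMeasure (partLaw μ R lhat htil ϑ pr M n s) := by
  rw [partLaw_eq_normalize]
  refine isProbabilityMeasure_normalize ?_ ?_
  · rw [hm.partRaw_univ hω hpos]
    exact (ENNReal.ofReal_pos.2 (hm.sum_mul_adj_pos hω hpos)).ne'
  · rw [hm.partRaw_univ hω hpos]
    exact ENNReal.ofReal_ne_top

omit hm [∀ k, IsMarkovKernel (R k)] in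
lemma partLaw_eq_zero (hω : ∀ i, (s i).2.2 = 0) : partLaw μ R lhat htil ϑ pr M n s = 0 := by
  simp [partLaw_eq_normalize, normalize, partRaw, hω]

omit [∀ k, IsMarkovKernel (R k)] in
lemma ae_bind_offspringLaw_bound (hM : 1 ≤ M) {K D : ℝ} (hτ : ∀ i, |(s i).2.1| ≤ K)
    (hD : ∀ x y, |htil n x y| ≤ D) (x : X n) :
    ∀ᵐ p ∂((propLaw μ pr n x).bind (offspringLaw R lhat htil ϑ pr M n s x)),
      |p.2.1| ≤ K + D ∧ 0 ≤ p.2.2 ∧ p.2.2 ≤ C :=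
  ae_bind_of_forall (by measurability)
    (Eventually.of_forall fun x' => hm.ae_offspringLaw_bound hM hτ hD x x')

omit [∀ k, IsMarkovKernel (R k)] in
lemma ae_partLaw_bound (hM : 1 ≤ M) {K D : ℝ} (hτ : ∀ i, |(s i).2.1| ≤ K)
    (hD : ∀ x y, |htil n x y| ≤ D) :
    ∀ᵐ p ∂(partLaw μ R lhat htil ϑ pr M n s), |p.2.1| ≤ K + D ∧ 0 ≤ p.2.2 ∧ p.2.2 ≤ C := by
  rw [partLaw_eq_normalize]
  refine ae_normalize (Measure.ae_sum_iff.2 fun i => Measure.ae_smul_measure ?_ _)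
  exact hm.ae_bind_offspringLaw_bound hM hτ hD _

lemma abs_integral_bsLaw_le (hM : 1 ≤ M) (hω : ∀ i, 0 ≤ (s i).2.2)
    (hpos : 0 < ∑ i, (s i).2.2) {K D : ℝ} (hτ : ∀ i, |(s i).2.1| ≤ K)
    (hD : ∀ x y, |htil n x y| ≤ D) (x' : X (n + 1)) :
    |∫ t, t ∂(bsLaw R lhat htil M n s x')| ≤ K + D := by
  have := hm.isProbabilityMeasure_bsLaw (M := M) hω hpos x'
  simpa using norm_integral_le_of_norm_le_const (μ := bsLaw R lhat htil M n s x')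
    (f := fun t : ℝ => t) (C := K + D) (ae_bsLaw_abs_le hM hτ hD x')

lemma measurable_integral_bsLaw : Measurable fun x' => ∫ t, t ∂(bsLaw R lhat htil M n s x') := by
  let κ : Kernel (X (n + 1)) ℝ := ⟨bsLaw R lhat htil M n s, hm.measurable_bsLaw⟩
  have : IsFiniteKernel κ := ⟨1, ENNReal.one_lt_top, fun x' => bsLaw_univ_le_one x'⟩
  exact (StronglyMeasurable.integral_kernel (κ := κ)
    measurable_id'.stronglyMeasurable).measurable

lemma integral_bind_offspringLaw (hM : 1 ≤ M) (hω : ∀ i, 0 ≤ (s i).2.2)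
    (hpos : 0 < ∑ i, (s i).2.2) {K : ℝ} (hτ : ∀ i, |(s i).2.1| ≤ K)
    {f ft : X (n + 1) → ℝ} (hf : Measurable f) (hft : Measurable ft) {Cf Cft : ℝ}
    (hfb : ∀ x, |f x| ≤ Cf) (hftb : ∀ x, |ft x| ≤ Cft) (x : X n) :
    Integrable (fun p => p.2.2 * (p.2.1 * f p.1 + ft p.1))
        ((propLaw μ pr n x).bind (offspringLaw R lhat htil ϑ pr M n s x)) ∧
      ϑ n x * ∫ p, p.2.2 * (p.2.1 * f p.1 + ft p.1)
          ∂((propLaw μ pr n x).bind (offspringLaw R lhat htil ϑ pr M n s x)) =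
        ∫ y, lEps R lhat n x y * ((∫ t, t ∂(bsLaw R lhat htil M n s y)) * f y + ft y)
          ∂μ (n + 1) := by
  obtain ⟨D, hD⟩ := hm.htil_bdd n
  have := hm.isProbabilityMeasure_propLaw x
  have := hm.isProbabilityMeasure_offspringLaw (M := M) hω hpos x
  have := hm.isProbabilityMeasure_bind_offspringLaw (M := M) hω hpos x
  have hgm : Measurable fun p : X (n + 1) × ℝ × ℝ => p.2.2 * (p.2.1 * f p.1 + ft p.1) :=
    measurable_snd.snd.mul ((measurable_snd.fst.mul (hf.comp measurable_fst)).add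
      (hft.comp measurable_fst))
  have hint : Integrable (fun p => p.2.2 * (p.2.1 * f p.1 + ft p.1))
      ((propLaw μ pr n x).bind (offspringLaw R lhat htil ϑ pr M n s x)) := by
    refine Integrable.of_bound hgm.aestronglyMeasurable (C * ((K + D) * Cf + Cft)) ?_
    filter_upwards [hm.ae_bind_offspringLaw_bound hM hτ hD x] with p ⟨h1, h2, h3⟩
    rw [norm_mul, Real.norm_of_nonneg h2, Real.norm_eq_abs]
    have h4 : |p.2.1 * f p.1 + ft p.1| ≤ (K + D) * Cf + Cft := by
      refine (abs_add_le _ _).trans (add_le_add ?_ (hftb _))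
      rw [abs_mul]
      exact mul_le_mul h1 (hfb _) (abs_nonneg _) ((abs_nonneg _).trans h1)
    exact mul_le_mul h3 h4 (abs_nonneg _) (h2.trans h3)
  refine ⟨hint, ?_⟩
  rw [integral_bind_of_measurable (hm.measurable_offspringLaw x) hint]
  simp only [hm.integral_offspringLaw hM hω hpos hτ hf hft]
  rw [propLaw, integral_withDensity_eq_integral_toReal_smul
    (hm.measurable_prop_right n x).ennreal_ofReal
    (Eventually.of_forall fun _ => ENNReal.ofReal_lt_top), ← integral_const_mul]
  refine integral_congr_ae (Eventually.of_forall fun y => ?_)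
  have h1 := (hm.adj_pos n x).ne'
  have h2 := (hm.prop_pos n x y).ne'
  simp only [ENNReal.toReal_ofReal (hm.prop_pos n x y).le, smul_eq_mul]
  field_simp

/-- The conditional mean of a weighted affine statistic of a new particle. -/
lemma integral_partLaw (hM : 1 ≤ M) (hω : ∀ i, 0 ≤ (s i).2.2)
    (hpos : 0 < ∑ i, (s i).2.2) {K : ℝ} (hτ : ∀ i, |(s i).2.1| ≤ K)
    {f ft : X (n + 1) → ℝ} (hf : Measurable f) (hft : Measurable ft) {Cf Cft : ℝ}
    (hfb : ∀ x, |f x| ≤ Cf) (hftb : ∀ x, |ft x| ≤ Cft) :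
    ∫ p, p.2.2 * (p.2.1 * f p.1 + ft p.1) ∂(partLaw μ R lhat htil ϑ pr M n s) =
      (∑ i, (s i).2.2 * ((s i).2.1 * Lop μ (lEps R lhat) n f (s i).1 +
        ∫ y, lEps R lhat n (s i).1 y * (htil n (s i).1 y * f y + ft y) ∂μ (n + 1))) /
        ∑ i, (s i).2.2 * ϑ n (s i).1 := by
  obtain ⟨D, hD⟩ := hm.htil_bdd n
  have hbind := fun x => hm.integral_bind_offspringLaw hM hω hpos hτ hf hft hfb hftb x
  set S : X (n + 1) → ℝ := fun x' => ∫ t, t ∂(bsLaw R lhat htil M n s x') with hS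
  have hSm : Measurable S := hm.measurable_integral_bsLaw
  have hSb : ∀ y, |S y| ≤ K + D := hm.abs_integral_bsLaw_le hM hω hpos hτ hD
  have hSint : ∀ x, Integrable (fun y => lEps R lhat n x y * (S y * f y + ft y)) (μ (n + 1)) :=
    fun x => hm.integrable_lEps_mul n x ((hSm.mul hf).add hft) (D := (K + D) * Cf + Cft)
      fun y => (abs_add_le _ _).trans (add_le_add ((abs_mul _ _).trans_le
        (mul_le_mul (hSb y) (hfb y) (abs_nonneg _) ((abs_nonneg _).trans (hSb y)))) (hftb y))
  have hfint : ∀ x, Integrable (fun y => lEps R lhat n x y * f y) (μ (n + 1)) :=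
    fun x => hm.integrable_lEps_mul n x hf hfb
  have hhint : ∀ x, Integrable (fun y => lEps R lhat n x y * (htil n x y * f y + ft y))
      (μ (n + 1)) := fun x =>
    hm.integrable_lEps_mul n x ((((hm.measurable_htil n).comp
      (measurable_prodMk_left (x := x))).mul hf).add hft) (D := D * Cf + Cft)
      fun y => (abs_add_le _ _).trans (add_le_add ((abs_mul _ _).trans_le
        (mul_le_mul (hD x y) (hfb y) (abs_nonneg _) ((abs_nonneg _).trans (hD x y)))) (hftb y))
  rw [partLaw_eq_normalize, integral_normalize, hm.partRaw_univ hω hpos,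
    ENNReal.toReal_ofReal (hm.sum_mul_adj_pos hω hpos).le, div_eq_inv_mul, partRaw,
    Measure.sum_fintype, integral_finsetSum_measure fun i _ =>
      (hbind (s i).1).1.smul_measure ENNReal.ofReal_ne_top]
  congr 1
  have h1 : ∀ i, ∫ p, p.2.2 * (p.2.1 * f p.1 + ft p.1)
      ∂(ENNReal.ofReal (ϑ n (s i).1 * (s i).2.2) •
        (propLaw μ pr n (s i).1).bind (offspringLaw R lhat htil ϑ pr M n s (s i).1)) =
      ∫ y, (s i).2.2 * (lEps R lhat n (s i).1 y * (S y * f y + ft y)) ∂μ (n + 1) := fun i => by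
    rw [integral_smul_measure,
      ENNReal.toReal_ofReal (mul_nonneg (hm.adj_pos n _).le (hω i)), integral_const_mul,
      ← (hbind (s i).1).2, smul_eq_mul]
    ring
  have h2 : ∀ i, (s i).2.2 * ((s i).2.1 * Lop μ (lEps R lhat) n f (s i).1 +
        ∫ y, lEps R lhat n (s i).1 y * (htil n (s i).1 y * f y + ft y) ∂μ (n + 1)) =
      ∫ y, (s i).2.2 * ((s i).2.1 * (lEps R lhat n (s i).1 y * f y) +
        lEps R lhat n (s i).1 y * (htil n (s i).1 y * f y + ft y)) ∂μ (n + 1) := fun i => by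
    rw [integral_const_mul, integral_add ((hfint _).const_mul _) (hhint _), integral_const_mul,
      Lop]
  have h3 : ∀ i, Integrable (fun y => (s i).2.2 * ((s i).2.1 * (lEps R lhat n (s i).1 y * f y) +
        lEps R lhat n (s i).1 y * (htil n (s i).1 y * f y + ft y))) (μ (n + 1)) := fun i =>
    (((hfint (s i).1).const_mul _).add (hhint (s i).1)).const_mul _
  rw [Finset.sum_congr rfl fun i _ => h1 i, Finset.sum_congr rfl fun i _ => h2 i,
    ← integral_finsetSum _ fun i _ => (hSint (s i).1).const_mul _,
    ← integral_finsetSum _ fun i _ => h3 i]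
  refine integral_congr_ae (Eventually.of_forall fun y => ?_)
  have hl := (hm.sum_mul_lEps_pos hω hpos y).ne'
  have hSy : (∑ j, (s j).2.2 * lEps R lhat n (s j).1 y) * S y =
      ∑ j, (s j).2.2 * lEps R lhat n (s j).1 y * ((s j).2.1 + htil n (s j).1 y) := by
    rw [hS]
    simp only [hm.integral_bsLaw hM hω hpos y]
    rw [mul_inv_cancel_left₀ hl]
  change ∑ i, (s i).2.2 * (lEps R lhat n (s i).1 y * (S y * f y + ft y)) =
    ∑ i, (s i).2.2 * ((s i).2.1 * (lEps R lhat n (s i).1 y * f y) +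
      lEps R lhat n (s i).1 y * (htil n (s i).1 y * f y + ft y))
  calc ∑ i, (s i).2.2 * (lEps R lhat n (s i).1 y * (S y * f y + ft y))
      = (∑ i, (s i).2.2 * lEps R lhat n (s i).1 y) * S y * f y +
          ∑ i, (s i).2.2 * lEps R lhat n (s i).1 y * ft y := by
        rw [Finset.sum_mul, Finset.sum_mul, ← Finset.sum_add_distrib]
        exact Finset.sum_congr rfl fun i _ => by ring
    _ = _ := by
        rw [hSy, Finset.sum_mul, ← Finset.sum_add_distrib]
        exact Finset.sum_congr rfl fun i _ => by ring

end PartLaw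

end IsRegularModel

/-- The unnormalised marginal `χ L_0 ⋯ L_{n-1}` as a measure. -/
noncomputable def flowMeas (μ : ∀ n, Measure (X n)) (χ : Measure (X 0))
    (d : ∀ k, X k → X (k + 1) → ℝ) : (n : ℕ) → Measure (X n)
  | 0 => χ
  | n + 1 => (((flowMeas μ χ d n).prod (μ (n + 1))).withDensity fun q =>
      ENNReal.ofReal (d n q.1 q.2)).map Prod.snd

/-- Backward recursion for the conditional mean of the additive functional given the last
state. -/
noncomputable def retroMean (μ : ∀ n, Measure (X n)) (χ : Measure (X 0))
    (d : ∀ k, X k → X (k + 1) → ℝ) (htil : ∀ k, X k → X (k + 1) → ℝ) : (n : ℕ) → X n → ℝ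
  | 0, _ => 0
  | n + 1, y =>
      (∫ x, d n x y * (retroMean μ χ d htil n x + htil n x y) ∂(flowMeas μ χ d n)) /
        ∫ x, d n x y ∂(flowMeas μ χ d n)

omit [∀ n, MeasurableSpace (X n)] in
lemma addFun_snoc (htil : ∀ k, X k → X (k + 1) → ℝ) (n : ℕ) (p : Path X n) (y : X (n + 1)) :
    addFun htil (n + 1) (Fin.snoc p y : Path X (n + 1)) =
      addFun htil n p + htil n (p (Fin.last n)) y := by
  unfold addFun
  rw [Fin.sum_univ_castSucc]
  congr 1
  · refine Finset.sum_congr rfl fun i _ => ?_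
    simp only [Fin.succ_castSucc, Fin.snoc_castSucc]
    rfl
  · simp only [Fin.succ_last, Fin.snoc_castSucc, Fin.snoc_last]
    rfl

lemma pathInt_succ_last (μ : ∀ n, Measure (X n)) (χ : Measure (X 0))
    (d : ∀ k, X k → X (k + 1) → ℝ) (n : ℕ) (u : X (n + 1) → ℝ) :
    pathInt μ χ d (n + 1) (fun p => u (p (Fin.last (n + 1)))) =
      pathInt μ χ d n fun p => Lop μ d n u (p (Fin.last n)) := by
  simp only [pathInt, Fin.snoc_last, Lop]

namespace IsRegularModel

variable {μ : ∀ n, Measure (X n)} {R : ∀ k, Kernel (X k × X (k + 1)) (Z k)}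
  {lhat : ∀ k, X k → X (k + 1) → Z k → ℝ} {htil : ∀ k, X k → X (k + 1) → ℝ}
  {ϑ : ∀ k, X k → ℝ} {pr : ∀ k, X k → X (k + 1) → ℝ} {C : ℝ}

section Flow

variable (hm : IsRegularModel μ R lhat htil ϑ pr C) [∀ k, IsMarkovKernel (R k)]
  [∀ n, SigmaFinite (μ n)]
include hm

lemma lintegral_lEps_prod_lt_top (n : ℕ) (γ : Measure (X n)) [IsFiniteMeasure γ] :
    ∫⁻ q, ENNReal.ofReal (lEps R lhat n q.1 q.2) ∂(γ.prod (μ (n + 1))) < ⊤ := by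
  obtain ⟨D, hD⟩ := hm.adj_bdd n
  rw [lintegral_prod _ (hm.measurable_lEps n).ennreal_ofReal.aemeasurable]
  have h : ∀ x, ∫⁻ y, ENNReal.ofReal (lEps R lhat n x y) ∂μ (n + 1) ≤
      ENNReal.ofReal (C * D) := fun x => by
    calc ∫⁻ y, ENNReal.ofReal (lEps R lhat n x y) ∂μ (n + 1)
        ≤ ∫⁻ y, ENNReal.ofReal (C * ϑ n x) * ENNReal.ofReal (pr n x y) ∂μ (n + 1) := by
          refine lintegral_mono fun y => ?_
          rw [← ENNReal.ofReal_mul (mul_nonneg hm.bound_pos.le (hm.adj_pos n x).le), mul_assoc]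
          exact ENNReal.ofReal_le_ofReal (hm.lEps_le n x y)
      _ = ENNReal.ofReal (C * ϑ n x) := by
          rw [lintegral_const_mul _ (hm.measurable_prop_right n x).ennreal_ofReal,
            hm.lintegral_prop, mul_one]
      _ ≤ ENNReal.ofReal (C * D) :=
          ENNReal.ofReal_le_ofReal (mul_le_mul_of_nonneg_left (hD x) hm.bound_pos.le)
  refine (lintegral_mono h).trans_lt ?_
  rw [lintegral_const]
  exact ENNReal.mul_lt_top ENNReal.ofReal_lt_top (measure_lt_top _ _)

lemma integrable_lEps_prod (n : ℕ) (γ : Measure (X n)) [IsFiniteMeasure γ] :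
    Integrable (fun q : X n × X (n + 1) => lEps R lhat n q.1 q.2) (γ.prod (μ (n + 1))) := by
  rw [← lintegral_ofReal_ne_top_iff_integrable (hm.measurable_lEps n).aestronglyMeasurable
    (Eventually.of_forall fun q => (hm.lEps_pos n q.1 q.2).le)]
  exact (hm.lintegral_lEps_prod_lt_top n γ).ne

lemma integrable_lEps_prod_mul (n : ℕ) (γ : Measure (X n)) [IsFiniteMeasure γ]
    {g : X n × X (n + 1) → ℝ} (hg : Measurable g) {D : ℝ} (hD : ∀ q, |g q| ≤ D) :
    Integrable (fun q : X n × X (n + 1) => lEps R lhat n q.1 q.2 * g q)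
      (γ.prod (μ (n + 1))) :=
  (hm.integrable_lEps_prod n γ).mul_bdd hg.aestronglyMeasurable (Eventually.of_forall hD)

variable (χ : Measure (X 0)) [IsFiniteMeasure χ]

lemma isFiniteMeasure_flowMeas (n : ℕ) :
    IsFiniteMeasure (flowMeas μ χ (lEps R lhat) n) := by
  induction n with
  | zero => assumption
  | succ n ih =>
    have := isFiniteMeasure_withDensity (hm.lintegral_lEps_prod_lt_top n
      (flowMeas μ χ (lEps R lhat) n)).ne
    rw [flowMeas]
    infer_instance

lemma flowMeas_succ_absolutelyContinuous (n : ℕ) :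
    flowMeas μ χ (lEps R lhat) (n + 1) ≪ μ (n + 1) := by
  have := hm.isFiniteMeasure_flowMeas χ n
  exact ((withDensity_absolutelyContinuous _ _).map measurable_snd).trans
    Measure.quasiMeasurePreserving_snd.absolutelyContinuous

omit [∀ n, SigmaFinite (μ n)] [IsFiniteMeasure χ] in
lemma integrable_flowMeas_succ_iff (n : ℕ) {u : X (n + 1) → ℝ}
    (hu : AEStronglyMeasurable u (flowMeas μ χ (lEps R lhat) (n + 1))) :
    Integrable u (flowMeas μ χ (lEps R lhat) (n + 1)) ↔
      Integrable (fun q : X n × X (n + 1) => lEps R lhat n q.1 q.2 * u q.2)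
        ((flowMeas μ χ (lEps R lhat) n).prod (μ (n + 1))) := by
  rw [flowMeas] at hu ⊢
  rw [integrable_map_measure hu measurable_snd.aemeasurable,
    integrable_withDensity_iff_integrable_smul' (hm.measurable_lEps n).ennreal_ofReal
      (Eventually.of_forall fun _ => ENNReal.ofReal_lt_top)]
  simp only [ENNReal.toReal_ofReal (hm.lEps_pos n _ _).le, smul_eq_mul, Function.comp_apply]

omit [∀ n, SigmaFinite (μ n)] [IsFiniteMeasure χ] in
lemma integral_flowMeas_succ (n : ℕ) {u : X (n + 1) → ℝ}
    (hu : AEStronglyMeasurable u (flowMeas μ χ (lEps R lhat) (n + 1))) :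
    ∫ y, u y ∂(flowMeas μ χ (lEps R lhat) (n + 1)) =
      ∫ q, lEps R lhat n q.1 q.2 * u q.2
        ∂((flowMeas μ χ (lEps R lhat) n).prod (μ (n + 1))) := by
  rw [flowMeas] at hu ⊢
  rw [integral_map measurable_snd.aemeasurable hu,
    integral_withDensity_eq_integral_toReal_smul (hm.measurable_lEps n).ennreal_ofReal
      (Eventually.of_forall fun _ => ENNReal.ofReal_lt_top)]
  simp only [ENNReal.toReal_ofReal (hm.lEps_pos n _ _).le, smul_eq_mul]

lemma integrable_Lop (n : ℕ) {u : X (n + 1) → ℝ}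
    (hu : Integrable u (flowMeas μ χ (lEps R lhat) (n + 1))) :
    Integrable (Lop μ (lEps R lhat) n u) (flowMeas μ χ (lEps R lhat) n) :=
  have := hm.isFiniteMeasure_flowMeas χ n
  ((hm.integrable_flowMeas_succ_iff χ n hu.1).1 hu).integral_prod_left

lemma integral_Lop (n : ℕ) {u : X (n + 1) → ℝ}
    (hu : Integrable u (flowMeas μ χ (lEps R lhat) (n + 1))) :
    ∫ x, Lop μ (lEps R lhat) n u x ∂(flowMeas μ χ (lEps R lhat) n) =
      ∫ y, u y ∂(flowMeas μ χ (lEps R lhat) (n + 1)) := by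
  have := hm.isFiniteMeasure_flowMeas χ n
  rw [hm.integral_flowMeas_succ χ n hu.1,
    integral_prod _ ((hm.integrable_flowMeas_succ_iff χ n hu.1).1 hu)]
  rfl

lemma pathInt_last (n : ℕ) {u : X n → ℝ} (hu : Integrable u (flowMeas μ χ (lEps R lhat) n)) :
    pathInt μ χ (lEps R lhat) n (fun p => u (p (Fin.last n))) =
      ∫ x, u x ∂(flowMeas μ χ (lEps R lhat) n) := by
  induction n with
  | zero => rfl
  | succ n ih => rw [pathInt_succ_last, ih (hm.integrable_Lop χ n hu), hm.integral_Lop χ n hu]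

lemma measurable_retroMean (n : ℕ) : Measurable (retroMean μ χ (lEps R lhat) htil n) := by
  induction n with
  | zero => exact measurable_const
  | succ n ih =>
    have := hm.isFiniteMeasure_flowMeas χ n
    have h1 : StronglyMeasurable fun y => ∫ x, lEps R lhat n x y *
        (retroMean μ χ (lEps R lhat) htil n x + htil n x y) ∂(flowMeas μ χ (lEps R lhat) n) :=
      StronglyMeasurable.integral_prod_left
        (f := fun x y => lEps R lhat n x y *
          (retroMean μ χ (lEps R lhat) htil n x + htil n x y))
        ((hm.measurable_lEps n).mul
          ((ih.comp measurable_fst).add (hm.measurable_htil n))).stronglyMeasurable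
    have h2 : StronglyMeasurable fun y => ∫ x, lEps R lhat n x y
        ∂(flowMeas μ χ (lEps R lhat) n) :=
      StronglyMeasurable.integral_prod_left (f := lEps R lhat n)
        (hm.measurable_lEps n).stronglyMeasurable
    exact h1.measurable.div h2.measurable

omit [∀ n, SigmaFinite (μ n)] [IsFiniteMeasure χ] in
lemma abs_retroMean_le (n : ℕ) : ∃ K, ∀ x, |retroMean μ χ (lEps R lhat) htil n x| ≤ K := by
  induction n with
  | zero => exact ⟨0, fun x => by simp [retroMean]⟩
  | succ n ih =>
    obtain ⟨K, hK⟩ := ih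
    obtain ⟨D, hD⟩ := hm.htil_bdd n
    refine ⟨|K + D|, fun y => ?_⟩
    rw [retroMean, abs_div]
    by_cases hint : Integrable (fun x => lEps R lhat n x y) (flowMeas μ χ (lEps R lhat) n)
    · refine div_le_of_le_mul₀ (abs_nonneg _) (abs_nonneg _) ?_
      have h := norm_integral_le_of_norm_le (μ := flowMeas μ χ (lEps R lhat) n)
        (f := fun x => lEps R lhat n x y *
          (retroMean μ χ (lEps R lhat) htil n x + htil n x y))
        (hint.const_mul |K + D|) (Eventually.of_forall fun x => ?_)
      · rw [integral_const_mul] at h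
        exact h.trans (mul_le_mul_of_nonneg_left (le_abs_self _) (abs_nonneg _))
      · rw [norm_mul, Real.norm_of_nonneg (hm.lEps_pos n x y).le, mul_comm]
        refine mul_le_mul_of_nonneg_right ?_ (hm.lEps_pos n x y).le
        exact ((abs_add_le _ _).trans (add_le_add (hK x) (hD x y))).trans (le_abs_self _)
    · rw [integral_undef hint]
      simp

lemma pathInt_one (n : ℕ) :
    pathInt μ χ (lEps R lhat) n (fun _ => 1) =
      (flowMeas μ χ (lEps R lhat) n).real Set.univ := by
  have := hm.isFiniteMeasure_flowMeas χ n
  have h := hm.pathInt_last χ n (integrable_const (1 : ℝ))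
  simpa using h

lemma ae_integrable_lEps_left (n : ℕ) :
    ∀ᵐ y ∂μ (n + 1), Integrable (fun x => lEps R lhat n x y)
      (flowMeas μ χ (lEps R lhat) n) :=
  have := hm.isFiniteMeasure_flowMeas χ n
  (hm.integrable_lEps_prod n (flowMeas μ χ (lEps R lhat) n)).prod_left_ae

variable (hZ : ∀ n, 0 < pathInt μ χ (lEps R lhat) n fun _ => 1)
include hZ

lemma flowMeas_univ_pos (n : ℕ) : 0 < flowMeas μ χ (lEps R lhat) n Set.univ := by
  have h := hZ n
  rw [hm.pathInt_one χ] at h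
  exact (ENNReal.toReal_pos_iff.1 h).1

lemma integral_flowMeas_pos (n : ℕ) {u : X n → ℝ} (hu : ∀ x, 0 < u x)
    (hint : Integrable u (flowMeas μ χ (lEps R lhat) n)) :
    0 < ∫ x, u x ∂(flowMeas μ χ (lEps R lhat) n) := by
  rw [integral_pos_iff_support_of_nonneg (fun x => (hu x).le) hint,
    Set.eq_univ_of_forall (s := Function.support u) fun x => (hu x).ne']
  exact hm.flowMeas_univ_pos χ hZ n

lemma marg_div_marg (n : ℕ) {u v : X n → ℝ}
    (hu : Integrable u (flowMeas μ χ (lEps R lhat) n))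
    (hv : Integrable v (flowMeas μ χ (lEps R lhat) n)) :
    marg μ χ (lEps R lhat) n u / marg μ χ (lEps R lhat) n v =
      (∫ x, u x ∂(flowMeas μ χ (lEps R lhat) n)) /
        ∫ x, v x ∂(flowMeas μ χ (lEps R lhat) n) := by
  rw [marg, marg, smoothPath, smoothPath, hm.pathInt_last χ n hu, hm.pathInt_last χ n hv,
    div_div_div_cancel_right₀ (hZ n).ne']

/-- The iterated backward kernel applied to the additive functional is given by the backward
recursion `retroMean`. -/
lemma ae_Tback_eq_retroMean (n : ℕ) : ∀ᵐ x ∂(flowMeas μ χ (lEps R lhat) n), ∀ g : X n → ℝ,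
    Tback μ χ (lEps R lhat) n (fun p => addFun htil n p + g (p (Fin.last n))) x =
      retroMean μ χ (lEps R lhat) htil n x + g x := by
  induction n with
  | zero =>
    refine Eventually.of_forall fun x g => ?_
    simp only [Tback, retroMean, addFun, Finset.univ_eq_empty, Finset.sum_empty]
    rfl
  | succ n ih =>
    have := hm.isFiniteMeasure_flowMeas χ n
    filter_upwards [hm.flowMeas_succ_absolutelyContinuous χ n
      (hm.ae_integrable_lEps_left χ n)] with y hy g
    obtain ⟨K, hK⟩ := hm.abs_retroMean_le χ n
    obtain ⟨D, hD⟩ := hm.htil_bdd n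
    have hTm := hm.measurable_retroMean χ n
    have hb : Integrable (fun x => lEps R lhat n x y *
        (retroMean μ χ (lEps R lhat) htil n x + htil n x y))
        (flowMeas μ χ (lEps R lhat) n) :=
      hy.mul_bdd (c := K + D) (hTm.add ((hm.measurable_htil n).comp
        (measurable_prodMk_right (y := y)))).aestronglyMeasurable
        (Eventually.of_forall fun x => (abs_add_le _ _).trans (add_le_add (hK x) (hD x y)))
    have hae : (fun x => lEps R lhat n x y * Tback μ χ (lEps R lhat) n
        (fun p => addFun htil (n + 1) (Fin.snoc p y : Path X (n + 1)) +
          g ((Fin.snoc p y : Path X (n + 1)) (Fin.last (n + 1)))) x)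
        =ᵐ[flowMeas μ χ (lEps R lhat) n]
        fun x => lEps R lhat n x y * (retroMean μ χ (lEps R lhat) htil n x + htil n x y) +
          lEps R lhat n x y * g y := by
      filter_upwards [ih] with x hx
      have h := hx fun x => htil n x y + g y
      simp only [addFun_snoc, Fin.snoc_last, add_assoc]
      rw [h]
      ring
    have hint := hb.add (hy.mul_const (g y))
    rw [Tback, Bop, hm.marg_div_marg χ hZ n (hint.congr hae.symm) hy, integral_congr_ae hae,
      integral_add hb (hy.mul_const _), integral_mul_const, add_div,
      mul_div_cancel_left₀ _ (hm.integral_flowMeas_pos χ hZ n (fun x => hm.lEps_pos n x y) hy).ne']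
    rfl

lemma integral_retroMean_succ (n : ℕ) {f ft : X (n + 1) → ℝ} (hf : Measurable f)
    (hft : Measurable ft) {Cf Cft : ℝ} (hfb : ∀ x, |f x| ≤ Cf) (hftb : ∀ x, |ft x| ≤ Cft) :
    ∫ y, (retroMean μ χ (lEps R lhat) htil (n + 1) y * f y + ft y)
        ∂(flowMeas μ χ (lEps R lhat) (n + 1)) =
      ∫ x, (retroMean μ χ (lEps R lhat) htil n x * Lop μ (lEps R lhat) n f x +
        ∫ y, lEps R lhat n x y * (htil n x y * f y + ft y) ∂μ (n + 1))
        ∂(flowMeas μ χ (lEps R lhat) n) := by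
  have := hm.isFiniteMeasure_flowMeas χ n
  obtain ⟨D, hD⟩ := hm.htil_bdd n
  obtain ⟨K, hK⟩ := hm.abs_retroMean_le χ n
  obtain ⟨K', hK'⟩ := hm.abs_retroMean_le χ (n + 1)
  have hTm := hm.measurable_retroMean χ n
  have hTm' := hm.measurable_retroMean χ (n + 1)
  have bound : ∀ {a b c K₁ K₂ K₃ : ℝ}, |a| ≤ K₁ → |b| ≤ K₂ → |c| ≤ K₃ →
      |a * b + c| ≤ K₁ * K₂ + K₃ := fun h1 h2 h3 =>
    (abs_add_le _ _).trans (add_le_add ((abs_mul _ _).trans_le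
      (mul_le_mul h1 h2 (abs_nonneg _) ((abs_nonneg _).trans h1))) h3)
  have hint1 := hm.integrable_lEps_prod_mul n (flowMeas μ χ (lEps R lhat) n)
    (g := fun q => retroMean μ χ (lEps R lhat) htil (n + 1) q.2 * f q.2 + ft q.2)
    (((hTm'.mul hf).add hft).comp measurable_snd) fun q => bound (hK' q.2) (hfb q.2) (hftb q.2)
  have hint2 := hm.integrable_lEps_prod_mul n (flowMeas μ χ (lEps R lhat) n)
    (g := fun q => (retroMean μ χ (lEps R lhat) htil n q.1 + htil n q.1 q.2) * f q.2 + ft q.2)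
    ((((hTm.comp measurable_fst).add (hm.measurable_htil n)).mul (hf.comp measurable_snd)).add
      (hft.comp measurable_snd)) fun q =>
      bound ((abs_add_le _ _).trans (add_le_add (hK q.1) (hD q.1 q.2))) (hfb q.2) (hftb q.2)
  rw [hm.integral_flowMeas_succ χ n (u := fun y => retroMean μ χ (lEps R lhat) htil (n + 1) y *
      f y + ft y) ((hTm'.mul hf).add hft).aestronglyMeasurable,
    integral_prod_symm _ hint1]
  trans ∫ y, ∫ x, lEps R lhat n x y * ((retroMean μ χ (lEps R lhat) htil n x + htil n x y) *
    f y + ft y) ∂(flowMeas μ χ (lEps R lhat) n) ∂μ (n + 1)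
  · refine integral_congr_ae ?_
    filter_upwards [hm.ae_integrable_lEps_left χ n] with y hy
    have hb : Integrable (fun x => lEps R lhat n x y *
        (retroMean μ χ (lEps R lhat) htil n x + htil n x y))
        (flowMeas μ χ (lEps R lhat) n) :=
      hy.mul_bdd (c := K + D) (hTm.add ((hm.measurable_htil n).comp
        (measurable_prodMk_right (y := y)))).aestronglyMeasurable
        (Eventually.of_forall fun x => (abs_add_le _ _).trans (add_le_add (hK x) (hD x y)))
    have hl := (hm.integral_flowMeas_pos χ hZ n (fun x => hm.lEps_pos n x y) hy).ne'
    simp only [mul_add (lEps R lhat n _ y) (_ * _) (ft y),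
      ← mul_assoc (lEps R lhat n _ y) _ (f y)]
    rw [integral_add (hb.mul_const _) (hy.mul_const _), integral_mul_const, integral_mul_const]
    simp only [mul_assoc (lEps R lhat n _ y) _ (f y)]
    rw [integral_add (hy.mul_const _) (hy.mul_const _), integral_mul_const, integral_mul_const,
      retroMean]
    field_simp
  · rw [← integral_prod_symm _ hint2, integral_prod _ hint2]
    refine integral_congr_ae (Eventually.of_forall fun x => ?_)
    have h1 := hm.integrable_lEps_mul n x hf hfb
    have h2 := hm.integrable_lEps_mul n x (g := fun y => htil n x y * f y + ft y)
      ((((hm.measurable_htil n).comp (measurable_prodMk_left (x := x))).mul hf).add hft)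
      fun y => bound (hD x y) (hfb y) (hftb y)
    change _ = retroMean μ χ (lEps R lhat) htil n x *
      (∫ y, lEps R lhat n x y * f y ∂μ (n + 1)) +
      ∫ y, lEps R lhat n x y * (htil n x y * f y + ft y) ∂μ (n + 1)
    rw [← integral_const_mul, ← integral_add (h1.const_mul _) h2]
    refine integral_congr_ae (Eventually.of_forall fun y => ?_)
    ring

lemma Tback_addFun_ae_eq (n : ℕ) :
    Tback μ χ (lEps R lhat) n (addFun htil n) =ᵐ[flowMeas μ χ (lEps R lhat) n]
      retroMean μ χ (lEps R lhat) htil n := by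
  filter_upwards [hm.ae_Tback_eq_retroMean χ hZ n] with x hx
  simpa using hx 0

end Flow

end IsRegularModel

section Ratio

variable {Ω : ℕ → Type*} [∀ N, MeasurableSpace (Ω N)] {P : ∀ N, Measure (Ω N)}

lemma ConcentratesAt.div_of_mean {A B : ∀ N, Ω N → ℝ} {a b K : ℝ}
    (hA : ConcentratesAt P (fun N ω => (N : ℝ)⁻¹ * A N ω) a)
    (hB : ConcentratesAt P (fun N ω => (N : ℝ)⁻¹ * B N ω) b) (hb : 0 < b) (hK : 0 ≤ K)
    (h : ∀ N, ∀ᵐ ω ∂P N, |A N ω| ≤ K * |B N ω|) :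
    ConcentratesAt P (fun N ω => A N ω / B N ω) (a / b) := by
  obtain ⟨c, hc, d, hd, h⟩ := hA.div hB hb hK fun N => by
    filter_upwards [h N] with ω hω
    rw [abs_mul, abs_mul, mul_left_comm]
    exact mul_le_mul_of_nonneg_left hω (abs_nonneg _)
  refine ⟨c, hc, d, hd, fun N hN ε hε => ?_⟩
  have hN' : (N : ℝ)⁻¹ ≠ 0 := inv_ne_zero (by exact_mod_cast (by omega : N ≠ 0))
  simpa only [mul_div_mul_left _ _ hN'] using h N hN ε hε

end Ratio

/-- The weighted affine statistic `∑ i, ω^i {τ^i f(ξ^i) + f̃(ξ^i)}`. -/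
def affineSum {n : ℕ} (f ft : X n → ℝ) (N : ℕ) (s : PState X N n) : ℝ :=
  ∑ i, (s i).2.2 * ((s i).2.1 * f (s i).1 + ft (s i).1)

/-- The normalising constant of the limit of the empirical means of `affineSum`. -/
noncomputable def adjMass (μ : ∀ n, Measure (X n)) (χ : Measure (X 0))
    (d : ∀ k, X k → X (k + 1) → ℝ) (ϑ : ∀ k, X k → ℝ) : ℕ → ℝ
  | 0 => 1
  | n + 1 => ∫ x, ϑ n x ∂(flowMeas μ χ d n)

lemma abs_sum_mul_le_mul_abs_sum {ι : Type*} [Fintype ι] {w a b : ι → ℝ} {K : ℝ}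
    (hw : ∀ i, 0 ≤ w i) (hab : ∀ i, |a i| ≤ K * b i) :
    |∑ i, w i * a i| ≤ |K| * |∑ i, w i * b i| := by
  rw [← abs_mul, Finset.mul_sum]
  refine (Finset.abs_sum_le_sum_abs _ _).trans (le_trans ?_ (le_abs_self _))
  refine Finset.sum_le_sum fun i _ => ?_
  rw [abs_mul, abs_of_nonneg (hw i), mul_left_comm]
  exact mul_le_mul_of_nonneg_left (hab i) (hw i)

lemma measurable_affineSum {n : ℕ} {f ft : X n → ℝ} (hf : Measurable f) (hft : Measurable ft)
    (N : ℕ) : Measurable (affineSum f ft N) :=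
  Finset.measurable_fun_sum _ fun i _ => by
    have hi : Measurable fun s : PState X N n => s i := measurable_pi_apply i
    exact hi.snd.snd.mul ((hi.snd.fst.mul (hf.comp hi.fst)).add (hft.comp hi.fst))

namespace IsRegularModel

variable {μ : ∀ n, Measure (X n)} {R : ∀ k, Kernel (X k × X (k + 1)) (Z k)}
  {lhat : ∀ k, X k → X (k + 1) → Z k → ℝ} {htil : ∀ k, X k → X (k + 1) → ℝ}
  {ϑ : ∀ k, X k → ℝ} {pr : ∀ k, X k → X (k + 1) → ℝ} {C : ℝ}

section System

variable {ν : Measure (X 0)} [IsProbabilityMeasure ν] {wm1 : X 0 → ℝ} {N M : ℕ}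

lemma partLaw_univ_le_one {n : ℕ} (s : PState X N n) :
    partLaw μ R lhat htil ϑ pr M n s Set.univ ≤ 1 :=
  normalize_univ_le_one _

instance isFiniteMeasure_partLaw {n : ℕ} (s : PState X N n) :
    IsFiniteMeasure (partLaw μ R lhat htil ϑ pr M n s) :=
  ⟨(partLaw_univ_le_one s).trans_lt ENNReal.one_lt_top⟩

lemma pi_partLaw_univ_le_one {n : ℕ} (s : PState X N n) :
    Measure.pi (fun _ : Fin N => partLaw μ R lhat htil ϑ pr M n s) Set.univ ≤ 1 := by
  rw [Measure.pi_univ]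
  exact Finset.prod_le_one' fun _ _ => partLaw_univ_le_one s

lemma measurable_initialState (hwm : Measurable wm1) :
    Measurable fun (ξ : Fin N → X 0) i => (ξ i, (0 : ℝ), wm1 (ξ i)) :=
  measurable_pi_lambda _ fun i => (measurable_pi_apply i).prodMk
    (measurable_const.prodMk (hwm.comp (measurable_pi_apply i)))

lemma sysLaw_univ_le_one (hwm : Measurable wm1) (n : ℕ) :
    sysLaw μ ν R lhat htil ϑ pr wm1 N M n Set.univ ≤ 1 := by
  induction n with
  | zero =>
    rw [sysLaw, Measure.map_apply (measurable_initialState hwm) MeasurableSet.univ]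
    exact prob_le_one
  | succ n ih =>
    rw [sysLaw]
    refine (Measure.bind_apply_le _ MeasurableSet.univ).trans
      ((lintegral_mono fun s => pi_partLaw_univ_le_one s).trans ?_)
    simpa using ih

variable (hm : IsRegularModel μ R lhat htil ϑ pr C)
include hm

omit [IsProbabilityMeasure ν] in
lemma ae_sysLaw_bound (hM : 1 ≤ M) (hwm : Measurable wm1) (hwm0 : ∀ x, 0 ≤ wm1 x) (n : ℕ) :
    ∃ K, ∀ N, ∀ᵐ s ∂(sysLaw μ ν R lhat htil ϑ pr wm1 N M n),
      ∀ i, |(s i).2.1| ≤ K ∧ 0 ≤ (s i).2.2 := by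
  have hmeas : ∀ (n N : ℕ) (K : ℝ),
      MeasurableSet {s : PState X N n | ∀ i, |(s i).2.1| ≤ K ∧ 0 ≤ (s i).2.2} := by
    intro n N K
    simp only [Set.ofPred_forall]
    refine MeasurableSet.iInter fun i => ?_
    have hi : Measurable fun s : PState X N n => s i := measurable_pi_apply i
    exact (measurableSet_le hi.snd.fst.abs measurable_const).inter
      (measurableSet_le measurable_const hi.snd.snd)
  induction n with
  | zero =>
    refine ⟨0, fun N => ?_⟩
    rw [sysLaw, ae_map_iff (measurable_initialState hwm).aemeasurable (hmeas 0 N 0)]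
    exact Eventually.of_forall fun ξ i => ⟨by simp, hwm0 _⟩
  | succ n ih =>
    obtain ⟨K, hK⟩ := ih
    obtain ⟨D, hD⟩ := hm.htil_bdd n
    refine ⟨K + D, fun N => ?_⟩
    rw [sysLaw]
    refine ae_bind_of_forall (hmeas (n + 1) N (K + D)) ?_
    filter_upwards [hK N] with s hs
    rw [eventually_all]
    intro i
    have h := hm.ae_partLaw_bound hM (fun i => (hs i).1) hD
    filter_upwards [(Measure.quasiMeasurePreserving_eval
      (fun _ : Fin N => partLaw μ R lhat htil ϑ pr M n s) i).ae h] with t ht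
    exact ⟨ht.1, ht.2.1⟩

variable [∀ k, IsMarkovKernel (R k)] [∀ n, SigmaFinite (μ n)] (χ : Measure (X 0))
  [IsFiniteMeasure χ] (hZ : ∀ n, 0 < pathInt μ χ (lEps R lhat) n fun _ => 1)

lemma integrable_adj (n : ℕ) : Integrable (ϑ n) (flowMeas μ χ (lEps R lhat) n) := by
  have := hm.isFiniteMeasure_flowMeas χ n
  obtain ⟨D, hD⟩ := hm.adj_bdd n
  exact Integrable.of_bound (hm.measurable_adj n).aestronglyMeasurable D
    (Eventually.of_forall fun x => by
      rw [Real.norm_of_nonneg (hm.adj_pos n x).le]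
      exact hD x)

include hZ in
lemma adjMass_pos (n : ℕ) : 0 < adjMass μ χ (lEps R lhat) ϑ n := by
  cases n with
  | zero => exact one_pos
  | succ n => exact hm.integral_flowMeas_pos χ hZ n (hm.adj_pos n) (hm.integrable_adj χ n)

omit [∀ k, IsMarkovKernel (R k)] [∀ n, SigmaFinite (μ n)] [IsFiniteMeasure χ] in
lemma concentratesAt_affineSum_zero (hwm : Measurable wm1) (hwm0 : ∀ x, 0 ≤ wm1 x)
    (hwmC : ∀ x, wm1 x ≤ C) (hRN : χ = ν.withDensity fun x => ENNReal.ofReal (wm1 x))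
    {f ft : X 0 → ℝ} (hf : Measurable f) (hft : Measurable ft) {Cft : ℝ}
    (hftb : ∀ x, |ft x| ≤ Cft) :
    ConcentratesAt (fun N => sysLaw μ ν R lhat htil ϑ pr wm1 N M 0)
      (fun N s => (N : ℝ)⁻¹ * affineSum f ft N s)
      ((∫ x, (retroMean μ χ (lEps R lhat) htil 0 x * f x + ft x)
        ∂(flowMeas μ χ (lEps R lhat) 0)) / adjMass μ χ (lEps R lhat) ϑ 0) := by
  have hlim : (∫ x, (retroMean μ χ (lEps R lhat) htil 0 x * f x + ft x)
      ∂(flowMeas μ χ (lEps R lhat) 0)) / adjMass μ χ (lEps R lhat) ϑ 0 =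
      ∫ x, wm1 x * ft x ∂ν := by
    simp only [retroMean, adjMass, flowMeas, zero_mul, zero_add, div_one]
    rw [hRN, integral_withDensity_eq_integral_toReal_smul hwm.ennreal_ofReal
      (Eventually.of_forall fun _ => ENNReal.ofReal_lt_top)]
    simp only [ENNReal.toReal_ofReal (hwm0 _), smul_eq_mul]
  have hB : 0 < C * |Cft| + 1 :=
    add_pos_of_nonneg_of_pos (mul_nonneg hm.bound_pos.le (abs_nonneg _)) one_pos
  refine ⟨2, two_pos, 1 / (2 * (C * |Cft| + 1) ^ 2), by positivity, fun N hN ε hε => ?_⟩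
  have hset : MeasurableSet {s : PState X N 0 | ε ≤ |(N : ℝ)⁻¹ * affineSum f ft N s -
      ∫ x, wm1 x * ft x ∂ν|} :=
    measurableSet_le measurable_const
      (((measurable_affineSum hf hft N).const_mul _).sub_const _).abs
  rw [hlim]
  change ((Measure.pi fun _ : Fin N => ν).map fun ξ i => (ξ i, 0, wm1 (ξ i)))
    {s : PState X N 0 | ε ≤ |(N : ℝ)⁻¹ * affineSum f ft N s - ∫ x, wm1 x * ft x ∂ν|} ≤ _
  rw [Measure.map_apply (measurable_initialState hwm) hset]
  refine le_trans (le_of_eq ?_) (pi_measure_abs_mean_sub_integral_ge_le ν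
    (U := fun x => wm1 x * ft x) (hwm.mul hft) hB (Eventually.of_forall fun x => ?_) hN hε)
  · congr 1
    ext ξ
    simp [affineSum]
  · rw [abs_mul, abs_of_nonneg (hwm0 x)]
    have := mul_le_mul (hwmC x) ((hftb x).trans (le_abs_self _)) (abs_nonneg _) hm.bound_pos.le
    linarith

lemma measurable_Lop {n : ℕ} {f : X (n + 1) → ℝ} (hf : Measurable f) :
    Measurable (Lop μ (lEps R lhat) n f) :=
  (StronglyMeasurable.integral_prod_right (f := fun x y => lEps R lhat n x y * f y)
    ((hm.measurable_lEps n).mul (hf.comp measurable_snd)).stronglyMeasurable).measurable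

lemma measurable_integral_htil {n : ℕ} {f ft : X (n + 1) → ℝ} (hf : Measurable f)
    (hft : Measurable ft) :
    Measurable fun x => ∫ y, lEps R lhat n x y * (htil n x y * f y + ft y) ∂μ (n + 1) :=
  (StronglyMeasurable.integral_prod_right
    (f := fun x y => lEps R lhat n x y * (htil n x y * f y + ft y))
    ((hm.measurable_lEps n).mul (((hm.measurable_htil n).mul (hf.comp measurable_snd)).add
      (hft.comp measurable_snd))).stronglyMeasurable).measurable

omit [∀ n, SigmaFinite (μ n)] in
/-- Conditionally on the current state, the empirical mean over the next generation concentrates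
around its conditional expectation. -/
lemma pi_partLaw_affineSum_le (hM : 1 ≤ M) {n : ℕ} {K : ℝ} {D : ℝ}
    (hD : ∀ x y, |htil n x y| ≤ D)
    {f ft : X (n + 1) → ℝ} (hf : Measurable f) (hft : Measurable ft) {Cf Cft : ℝ}
    (hfb : ∀ x, |f x| ≤ Cf) (hftb : ∀ x, |ft x| ≤ Cft) (hN : 1 ≤ N) {s : PState X N n}
    (hs : ∀ i, |(s i).2.1| ≤ K ∧ 0 ≤ (s i).2.2) {ε : ℝ} (hε : 0 < ε) :
    Measure.pi (fun _ : Fin N => partLaw μ R lhat htil ϑ pr M n s)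
        {s' | ε ≤ |(N : ℝ)⁻¹ * affineSum f ft N s' -
          affineSum (Lop μ (lEps R lhat) n f)
            (fun x => ∫ y, lEps R lhat n x y * (htil n x y * f y + ft y) ∂μ (n + 1)) N s /
            affineSum 0 (ϑ n) N s|} ≤
      ENNReal.ofReal
        (2 * Real.exp (-(1 / (2 * (|C * ((K + D) * Cf + Cft)| + 1) ^ 2) * N * ε ^ 2))) := by
  have hω : ∀ i, 0 ≤ (s i).2.2 := fun i => (hs i).2
  rcases (Finset.sum_nonneg fun i _ => hω i).eq_or_lt with h0 | hpos
  · have hz : ∀ i, (s i).2.2 = 0 := fun i =>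
      (Finset.sum_eq_zero_iff_of_nonneg fun i _ => hω i).1 h0.symm i (Finset.mem_univ i)
    refine (measure_mono (Set.subset_univ _)).trans ?_
    rw [partLaw_eq_zero hz, Measure.pi_univ]
    have : N ≠ 0 := by omega
    simp [this]
  · have := hm.isProbabilityMeasure_partLaw (M := M) hω hpos
    have hmean := hm.integral_partLaw hM hω hpos (fun i => (hs i).1) hf hft hfb hftb
    have hU : Measurable fun p : X (n + 1) × ℝ × ℝ => p.2.2 * (p.2.1 * f p.1 + ft p.1) :=
      measurable_snd.snd.mul ((measurable_snd.fst.mul (hf.comp measurable_fst)).add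
        (hft.comp measurable_fst))
    have hUb : ∀ᵐ p ∂(partLaw μ R lhat htil ϑ pr M n s),
        |p.2.2 * (p.2.1 * f p.1 + ft p.1)| ≤ |C * ((K + D) * Cf + Cft)| + 1 := by
      filter_upwards [hm.ae_partLaw_bound hM (fun i => (hs i).1) hD] with p ⟨h1, h2, h3⟩
      have h4 : |p.2.1 * f p.1 + ft p.1| ≤ (K + D) * Cf + Cft := by
        refine (abs_add_le _ _).trans (add_le_add ?_ (hftb _))
        rw [abs_mul]
        exact mul_le_mul h1 (hfb _) (abs_nonneg _) ((abs_nonneg _).trans h1)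
      rw [abs_mul, abs_of_nonneg h2]
      have := mul_le_mul h3 h4 (abs_nonneg _) hm.bound_pos.le
      have := le_abs_self (C * ((K + D) * Cf + Cft))
      linarith
    have h := pi_measure_abs_mean_sub_integral_ge_le (partLaw μ R lhat htil ϑ pr M n s) hU
      (by positivity) hUb hN hε
    rw [hmean] at h
    simpa only [affineSum, Pi.zero_apply, mul_zero, zero_add] using h

include hZ in
/-- Empirical means of weighted affine statistics concentrate. -/
lemma concentratesAt_affineSum (hM : 1 ≤ M) (hwm : Measurable wm1) (hwm0 : ∀ x, 0 ≤ wm1 x)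
    (hwmC : ∀ x, wm1 x ≤ C) (hRN : χ = ν.withDensity fun x => ENNReal.ofReal (wm1 x)) (n : ℕ)
    {f ft : X n → ℝ} (hf : Measurable f) (hft : Measurable ft) {Cf Cft : ℝ}
    (hfb : ∀ x, |f x| ≤ Cf) (hftb : ∀ x, |ft x| ≤ Cft) :
    ConcentratesAt (fun N => sysLaw μ ν R lhat htil ϑ pr wm1 N M n)
      (fun N s => (N : ℝ)⁻¹ * affineSum f ft N s)
      ((∫ x, (retroMean μ χ (lEps R lhat) htil n x * f x + ft x)
        ∂(flowMeas μ χ (lEps R lhat) n)) / adjMass μ χ (lEps R lhat) ϑ n) := by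
  induction n generalizing Cf Cft with
  | zero => exact hm.concentratesAt_affineSum_zero χ hwm hwm0 hwmC hRN hf hft hftb
  | succ n ih =>
    obtain ⟨K, hK⟩ := hm.ae_sysLaw_bound (ν := ν) hM hwm hwm0 n
    obtain ⟨D, hD⟩ := hm.htil_bdd n
    obtain ⟨Cϑ, hCϑ⟩ := hm.adj_bdd n
    have hϑabs : ∀ x, |ϑ n x| = ϑ n x := fun x => abs_of_pos (hm.adj_pos n x)
    set ψ : X n → ℝ := fun x =>
      ∫ y, lEps R lhat n x y * (htil n x y * f y + ft y) ∂μ (n + 1) with hψ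
    have hLb : ∀ x, |Lop μ (lEps R lhat) n f x| ≤ Cf * C * ϑ n x := fun x =>
      hm.abs_integral_lEps_mul_le n x hfb
    have hψb : ∀ x, |ψ x| ≤ (D * Cf + Cft) * C * ϑ n x := fun x =>
      hm.abs_integral_lEps_mul_le n x fun y => (abs_add_le _ _).trans
        (add_le_add ((abs_mul _ _).trans_le (mul_le_mul (hD x y) (hfb y) (abs_nonneg _)
          ((abs_nonneg _).trans (hD x y)))) (hftb y))
    have hb : ∀ {a : ℝ} (x : X n), a * ϑ n x ≤ |a| * Cϑ := fun {a} x =>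
      mul_le_mul (le_abs_self a) (hCϑ x) (hm.adj_pos n x).le (abs_nonneg a)
    have hnum := ih (hm.measurable_Lop hf) (hm.measurable_integral_htil hf hft)
      (fun x => (hLb x).trans (hb x)) fun x => (hψb x).trans (hb x)
    have hden := ih (f := 0) measurable_const (hm.measurable_adj n) (Cf := 0) (by simp)
      fun x => (hϑabs x).trans_le (hCϑ x)
    have hκ := hm.adjMass_pos χ hZ n
    have hϑpos := hm.integral_flowMeas_pos χ hZ n (hm.adj_pos n) (hm.integrable_adj χ n)
    simp only [Pi.zero_apply, mul_zero, zero_add] at hden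
    have hratio := hnum.div_of_mean hden (div_pos hϑpos hκ)
      (abs_nonneg (K * (Cf * C) + (D * Cf + Cft) * C)) fun N => by
        filter_upwards [hK N] with s hs
        refine abs_sum_mul_le_mul_abs_sum (fun i => (hs i).2) fun i => ?_
        refine (abs_add_le _ _).trans ?_
        have h1 := mul_le_mul (hs i).1 (hLb (s i).1) (abs_nonneg _)
          ((abs_nonneg _).trans (hs i).1)
        rw [abs_mul]
        simp only [Pi.zero_apply, mul_zero, zero_add]
        linarith [hψb (s i).1]
    rw [div_div_div_cancel_right₀ hκ.ne',
      ← hm.integral_retroMean_succ χ hZ n hf hft hfb hftb] at hratio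
    refine ConcentratesAt.bind hratio (fun N => sysLaw_univ_le_one hwm n)
      (fun N s => pi_partLaw_univ_le_one s)
      (fun N => (measurable_affineSum hf hft N).const_mul _)
      (d₀ := 1 / (2 * (|C * ((K + D) * Cf + Cft)| + 1) ^ 2)) (by positivity) fun N hN => ?_
    filter_upwards [hK N] with s hs ε hε
    exact hm.pi_partLaw_affineSum_le hM hD hf hft hfb hftb hN hs hε

include hZ in
/-- Self-normalised weighted affine statistics concentrate. -/
lemma concentratesAt_affineSum_div (hM : 1 ≤ M) (hwm : Measurable wm1)
    (hwm0 : ∀ x, 0 ≤ wm1 x) (hwmC : ∀ x, wm1 x ≤ C)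
    (hRN : χ = ν.withDensity fun x => ENNReal.ofReal (wm1 x)) (n : ℕ)
    {f ft : X n → ℝ} (hf : Measurable f) (hft : Measurable ft) {Cf Cft : ℝ}
    (hfb : ∀ x, |f x| ≤ Cf) (hftb : ∀ x, |ft x| ≤ Cft) :
    ConcentratesAt (fun N => sysLaw μ ν R lhat htil ϑ pr wm1 N M n)
      (fun N s => affineSum f ft N s / ∑ i, (s i).2.2)
      ((∫ x, (retroMean μ χ (lEps R lhat) htil n x * f x + ft x)
        ∂(flowMeas μ χ (lEps R lhat) n)) / ∫ _, 1 ∂(flowMeas μ χ (lEps R lhat) n)) := by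
  have := hm.isFiniteMeasure_flowMeas χ n
  obtain ⟨K, hK⟩ := hm.ae_sysLaw_bound (ν := ν) hM hwm hwm0 n
  have hnum := hm.concentratesAt_affineSum χ hZ hM hwm hwm0 hwmC hRN n hf hft hfb hftb
  have hden := hm.concentratesAt_affineSum χ hZ hM hwm hwm0 hwmC hRN n (f := 0) (ft := 1)
    measurable_const measurable_const (Cf := 0) (Cft := 1) (by simp) (by simp)
  have hκ := hm.adjMass_pos χ hZ n
  have hpos := hm.integral_flowMeas_pos χ hZ n (fun _ => one_pos) (integrable_const (1 : ℝ))
  simp only [Pi.zero_apply, Pi.one_apply, mul_zero, zero_add] at hden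
  have h := hnum.div_of_mean hden (div_pos hpos hκ) (abs_nonneg (K * Cf + Cft)) fun N => by
    filter_upwards [hK N] with s hs
    refine abs_sum_mul_le_mul_abs_sum (fun i => (hs i).2) fun i => ?_
    simp only [Pi.zero_apply, Pi.one_apply, mul_zero, zero_add, mul_one]
    exact (abs_add_le _ _).trans (add_le_add ((abs_mul _ _).trans_le (mul_le_mul (hs i).1 (hfb _)
      (abs_nonneg _) ((abs_nonneg _).trans (hs i).1))) (hftb _))
  rw [div_div_div_cancel_right₀ hκ.ne'] at h
  simpa only [affineSum, Pi.zero_apply, Pi.one_apply, mul_zero, zero_add, mul_one] using h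

end System

end IsRegularModel

/-- **General Hoeffding bound for affine PaRIS statistics** (Proposition 2, stated at time
`n+1`): exponential concentration of `N⁻¹ ∑_i ω^i {τ^i f + f̃}` around
`φ^ε_n L^ε_n(T^ε_{n+1} h_{n+1} f + f̃) / φ^ε_n ϑ_n` (part (i)) and of the self-normalised
version around `φ^ε_{n+1}(T^ε_{n+1} h_{n+1} f + f̃)` (part (ii)). -/
theorem paris_hoeffding_affine
    -- the model
    (μ : ∀ n, Measure (X n)) [∀ n, SigmaFinite (μ n)]
    (χ : Measure (X 0)) [IsFiniteMeasure χ]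
    -- (H1): auxiliary kernels and transition-density estimators
    (R : ∀ k, Kernel (X k × X (k + 1)) (Z k)) [∀ k, IsMarkovKernel (R k)]
    (lhat : ∀ k, X k → X (k + 1) → Z k → ℝ)
    (hlhatmeas : ∀ k, Measurable fun q : (X k × X (k + 1)) × Z k => lhat k q.1.1 q.1.2 q.2)
    (hlhatpos : ∀ k x y z, 0 < lhat k x y z)
    -- positivity of the skew normalising constants
    (hZpos : ∀ n, 0 < pathInt μ χ (lEps R lhat) n fun _ => 1)
    -- adjustment weights, proposal densities, initial proposal
    (ϑ : ∀ k, X k → ℝ) (pr : ∀ k, X k → X (k + 1) → ℝ)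
    (ν : Measure (X 0)) [IsProbabilityMeasure ν] (wm1 : X 0 → ℝ)
    (hϑmeas : ∀ k, Measurable (ϑ k)) (hϑpos : ∀ k x, 0 < ϑ k x)
    (hprmeas : ∀ k, Measurable fun q : X k × X (k + 1) => pr k q.1 q.2)
    (hprpos : ∀ k x y, 0 < pr k x y)
    (hprmarkov : ∀ k x, ∫⁻ y, ENNReal.ofReal (pr k x y) ∂μ (k + 1) = 1)
    (hwm1meas : Measurable wm1) (hwm1nn : ∀ x, 0 ≤ wm1 x)
    (hRN : χ = ν.withDensity fun x => ENNReal.ofReal (wm1 x))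
    -- (H2): boundedness
    (hϑbdd : ∀ k, ∃ C, ∀ x, ϑ k x ≤ C)
    (hwhatbdd : ∃ C, ∀ k (x : X k) y z, lhat k x y z / (ϑ k x * pr k x y) ≤ C)
    (hwepsbdd : ∃ C, ∀ k (x : X k) y, lEps R lhat k x y / (ϑ k x * pr k x y) ≤ C)
    (hwm1bdd : ∃ C, ∀ x, wm1 x ≤ C)
    -- the additive functional
    (htil : ∀ k, X k → X (k + 1) → ℝ)
    (htilmeas : ∀ k, Measurable fun q : X k × X (k + 1) => htil k q.1 q.2)
    (htilbdd : ∀ k, ∃ C, ∀ x y, |htil k x y| ≤ C)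
    (n M : ℕ) (hM : 1 ≤ M)
    (f ft : X (n + 1) → ℝ) (Cf Cft : ℝ)
    (hfmeas : Measurable f) (hftmeas : Measurable ft)
    (hfbdd : ∀ x, |f x| ≤ Cf) (hftbdd : ∀ x, |ft x| ≤ Cft) :
    ∃ c > (0 : ℝ), ∃ d > (0 : ℝ), ∀ N : ℕ, 1 ≤ N → ∀ ϵ : ℝ, 0 < ϵ →
      sysLaw μ ν R lhat htil ϑ pr wm1 N M (n + 1)
          {s | ϵ ≤
            |(N : ℝ)⁻¹ * (∑ i, (s i).2.2 * ((s i).2.1 * f (s i).1 + ft (s i).1)) -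
              marg μ χ (lEps R lhat) n
                  (Lop μ (lEps R lhat) n fun y =>
                    Tback μ χ (lEps R lhat) (n + 1) (addFun htil (n + 1)) y * f y + ft y) /
                marg μ χ (lEps R lhat) n (ϑ n)|} ≤
        ENNReal.ofReal (c * Real.exp (-(d * N * ϵ ^ 2))) ∧
      sysLaw μ ν R lhat htil ϑ pr wm1 N M (n + 1)
          {s | ϵ ≤
            |(∑ i, (s i).2.2 * ((s i).2.1 * f (s i).1 + ft (s i).1)) / (∑ i, (s i).2.2) -
              marg μ χ (lEps R lhat) (n + 1) fun y =>
                Tback μ χ (lEps R lhat) (n + 1) (addFun htil (n + 1)) y * f y + ft y|} ≤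
        ENNReal.ofReal (c * Real.exp (-(d * N * ϵ ^ 2))) := by
  obtain ⟨Cw, hCw⟩ := hwhatbdd
  obtain ⟨Cν, hCν⟩ := hwm1bdd
  have hm : IsRegularModel μ R lhat htil ϑ pr (max (max Cw Cν) 1) :=
    { measurable_lhat := hlhatmeas
      lhat_pos := hlhatpos
      measurable_adj := hϑmeas
      adj_pos := hϑpos
      adj_bdd := hϑbdd
      measurable_prop := hprmeas
      prop_pos := hprpos
      lintegral_prop := hprmarkov
      weight_le := fun k x y z =>
        (hCw k x y z).trans ((le_max_left _ _).trans (le_max_left _ _))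
      measurable_htil := htilmeas
      htil_bdd := htilbdd
      bound_pos := one_pos.trans_le (le_max_right _ _) }
  have hwC : ∀ x, wm1 x ≤ max (max Cw Cν) 1 := fun x =>
    (hCν x).trans ((le_max_right _ _).trans (le_max_left _ _))
  have := hm.isFiniteMeasure_flowMeas χ (n + 1)
  obtain ⟨K, hK⟩ := hm.abs_retroMean_le χ (n + 1)
  have hT := hm.Tback_addFun_ae_eq χ hZpos (n + 1)
  have hv : Integrable (fun y => retroMean μ χ (lEps R lhat) htil (n + 1) y * f y + ft y)
      (flowMeas μ χ (lEps R lhat) (n + 1)) := by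
    refine Integrable.of_bound (((hm.measurable_retroMean χ (n + 1)).mul hfmeas).add
      hftmeas).aestronglyMeasurable (K * Cf + Cft) (Eventually.of_forall fun y => ?_)
    refine (norm_add_le _ _).trans (add_le_add ?_ (hftbdd y))
    rw [norm_mul]
    exact mul_le_mul (hK y) (hfbdd y) (norm_nonneg _) ((abs_nonneg _).trans (hK y))
  have huv : (fun y => Tback μ χ (lEps R lhat) (n + 1) (addFun htil (n + 1)) y * f y + ft y)
      =ᵐ[flowMeas μ χ (lEps R lhat) (n + 1)]
      fun y => retroMean μ χ (lEps R lhat) htil (n + 1) y * f y + ft y := by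
    filter_upwards [hT] with y hy
    rw [hy]
  have hu := hv.congr huv.symm
  obtain ⟨c₁, hc₁, d₁, hd₁, h₁⟩ :=
    hm.concentratesAt_affineSum χ hZpos hM hwm1meas hwm1nn hwC hRN (n + 1) hfmeas hftmeas hfbdd
      hftbdd
  obtain ⟨c₂, hc₂, d₂, hd₂, h₂⟩ :=
    hm.concentratesAt_affineSum_div χ hZpos hM hwm1meas hwm1nn hwC hRN (n + 1) hfmeas hftmeas
      hfbdd hftbdd
  have hle : ∀ {c d : ℝ}, 0 < c → c ≤ max c₁ c₂ → min d₁ d₂ ≤ d → ∀ (N : ℕ) (ϵ : ℝ),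
      ENNReal.ofReal (c * Real.exp (-(d * N * ϵ ^ 2))) ≤
        ENNReal.ofReal (max c₁ c₂ * Real.exp (-(min d₁ d₂ * N * ϵ ^ 2))) := by
    intro c d hc hcc hdd N ϵ
    gcongr
  refine ⟨max c₁ c₂, lt_max_of_lt_left hc₁, min d₁ d₂, lt_min hd₁ hd₂, fun N hN ϵ hϵ => ⟨?_, ?_⟩⟩
  · rw [hm.marg_div_marg χ hZpos n (hm.integrable_Lop χ n hu) (hm.integrable_adj χ n),
      hm.integral_Lop χ n hu, integral_congr_ae huv]
    exact (h₁ N hN ϵ hϵ).trans (hle hc₁ (le_max_left _ _) (min_le_left _ _) N ϵ)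
  · have hone := hm.pathInt_last χ (n + 1) (integrable_const (1 : ℝ))
    rw [marg, smoothPath, hm.pathInt_last χ (n + 1) hu, hone, integral_congr_ae huv]
    exact (h₂ N hN ϵ hϵ).trans (hle hc₂ (le_max_right _ _) (min_le_right _ _) N ϵ)

end PmParis
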